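/- Main theorem: let k ∈ {4,6,8,10,14} and p ∈ {2,3,5}, and define ε_{k,p} = 7 if p=2 and k ∈ {4,6,14}; 8 if p=2 and k ∈ {8,10}; 2 if p=3 and k ∈ {4,10}; 3 if p=3 and k ∈ {6,8,14}; 1 if p=5. Then for all m, n > 0: if v_p(m) > v_p(n) then v_p(a_k(m,n)) ≥ ε_{k,p}, and if v_p(n) > v_p(m) then v_p(a_k(m,n)) ≥ (v_p(n) - v_p(m))(k-1) + ε_{k,p}. -/

import Mathlib

open UpperHalfPlane Complex CongruenceSubgroup MatrixGroups
open scoped ModularForm Real MatrixGroups Manifold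

noncomputable section

/-- `q = e^{2 π i τ}`. -/
def qexp (τ : UpperHalfPlane) : ℂ := Complex.exp (2 * π * Complex.I * τ)

/-- `f` has the `q`-expansion `∑ c n qⁿ` at `∞`, with only finitely many negative terms. -/
def HasExpansion (f : UpperHalfPlane → ℂ) (c : ℤ → ℂ) : Prop :=
  (∃ N : ℤ, ∀ n : ℤ, n < N → c n = 0) ∧
    ∀ τ : UpperHalfPlane, HasSum (fun n : ℤ => c n * qexp τ ^ n) (f τ)

/-- Weakly holomorphic modular forms of weight `k` on `Γ`, together with their
Fourier coefficients. -/
structure WhmForm (Γ : Subgroup SL(2, ℤ)) (k : ℤ) where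
  toFun : UpperHalfPlane → ℂ
  coeff : ℤ → ℂ
  holo : MDifferentiable 𝓘(ℂ) 𝓘(ℂ) toFun
  slash_eq : ∀ γ ∈ Γ, toFun ∣[k] γ = toFun
  expansion : HasExpansion toFun coeff

/-- `f = q^{-m} + O(q^{ℓ+1})`. -/
def IsBasisElt {Γ : Subgroup SL(2, ℤ)} (k ℓ m : ℤ) (f : WhmForm Γ k) : Prop :=
  f.coeff (-m) = 1 ∧ ∀ n : ℤ, n ≠ -m → n ≤ ℓ → f.coeff n = 0

/-- multiplication of a point of the upper half plane by a positive real number. -/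
def rscale (a : ℝ) (ha : 0 < a) (τ : UpperHalfPlane) : UpperHalfPlane :=
  ⟨a * τ, by simpa [Complex.mul_im] using mul_pos ha τ.2⟩

/-- `τ ↦ -1/τ` on the upper half plane. -/
def neginv (τ : UpperHalfPlane) : UpperHalfPlane :=
  ⟨(-(τ : ℂ))⁻¹, τ.im_inv_neg_coe_pos⟩

/-- `a m n` is the integer Fourier coefficient `a_k(m,n)` of the canonical basis element
`f_{k,m} = q^{-m} + O(q)` (here `ℓ = 0`), with `a m n = 0` out of range. -/
def IsCoeffs (k : ℤ) (a : ℤ → ℤ → ℤ) : Prop :=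
  (∀ m : ℤ, 0 ≤ m → ∃ f : WhmForm ⊤ k, IsBasisElt k 0 m f ∧
      ∀ n : ℤ, 0 < n → f.coeff n = (a m n : ℂ)) ∧
  ∀ m n : ℤ, m < 0 ∨ n ≤ 0 → a m n = 0

/-- The exponent `ε_{k,p}` of the main theorem. -/
def eps (k p : ℕ) : ℕ :=
  if p = 2 then (if k = 8 ∨ k = 10 then 8 else 7)
  else if p = 3 then (if k = 4 ∨ k = 10 then 2 else 3)
  else 1

section Formal

variable {R S : Type*} [CommRing R] [CommRing S]

/-- A Laurent series has a uniform lower bound on its exponents. -/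
lemma laurent_exists_bound (x : LaurentSeries R) : ∃ a : ℤ, ∀ n < a, x.coeff n = 0 :=
  ⟨x.order, fun _ hn => HahnSeries.coeff_eq_zero_of_lt_order hn⟩

/-- The Cauchy product of two Laurent series as a sum over an interval. -/
lemma laurent_coeff_mul {x y : LaurentSeries R} {a b : ℤ} (hx : ∀ n < a, x.coeff n = 0)
    (hy : ∀ n < b, y.coeff n = 0) (n : ℤ) :
    (x * y).coeff n = ∑ i ∈ Finset.Icc a (n - b), x.coeff i * y.coeff (n - i) := by
  rw [HahnSeries.coeff_mul]
  refine Finset.sum_of_injOn Prod.fst ?_ ?_ ?_ ?_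
  · rintro ⟨i, j⟩ hi ⟨i', j'⟩ hi' h
    simp only [Finset.mem_coe, Finset.mem_antidiagonal] at hi hi' h
    ext <;> simp <;> omega
  · rintro ⟨i, j⟩ hi
    simp only [Finset.mem_coe, Finset.mem_antidiagonal, HahnSeries.mem_support] at hi
    have h1 : a ≤ i := by by_contra h; exact hi.1 (hx i (by omega))
    have h2 : b ≤ j := by by_contra h; exact hi.2.1 (hy j (by omega))
    simp only [Finset.coe_Icc, Set.mem_Icc]; omega
  · intro i _ hi
    by_contra h
    refine hi ⟨(i, n - i), ?_, rfl⟩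
    simp only [Finset.mem_coe, Finset.mem_antidiagonal, HahnSeries.mem_support]
    exact ⟨left_ne_zero_of_mul h, right_ne_zero_of_mul h, by omega⟩
  · rintro ⟨i, j⟩ hi
    simp only [Finset.mem_antidiagonal] at hi
    rw [show n - i = j by omega]

/-- `x = q^d + O(q^{d+1})`. -/
def IsMonicAt (x : LaurentSeries R) (d : ℤ) : Prop := (∀ n < d, x.coeff n = 0) ∧ x.coeff d = 1

lemma IsMonicAt.mul {x y : LaurentSeries R} {a b : ℤ} (hx : IsMonicAt x a) (hy : IsMonicAt y b) :
    IsMonicAt (x * y) (a + b) := by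
  refine ⟨fun n hn => ?_, ?_⟩
  · rw [laurent_coeff_mul hx.1 hy.1, Finset.Icc_eq_empty (by omega), Finset.sum_empty]
  · rw [laurent_coeff_mul hx.1 hy.1, show a + b - b = a by omega, Finset.Icc_self,
      Finset.sum_singleton, hx.2, show a + b - a = b by omega, hy.2, one_mul]

lemma isMonicAt_one : IsMonicAt (1 : LaurentSeries R) 0 :=
  ⟨fun n hn => by rw [HahnSeries.coeff_one, if_neg hn.ne], by simp⟩

lemma IsMonicAt.pow {x : LaurentSeries R} {a : ℤ} (hx : IsMonicAt x a) (n : ℕ) :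
    IsMonicAt (x ^ n) (n * a) := by
  induction n with
  | zero => simpa using isMonicAt_one
  | succ n ih =>
    rw [pow_succ]
    convert ih.mul hx using 1
    push_cast; ring

/-- `x = O(q^d)` implies `y * x = O(q^(a+d))` for `y = O(q^a)`. -/
lemma laurent_mul_coeff_eq_zero {x y : LaurentSeries R} {a b : ℤ} (hx : ∀ n < a, x.coeff n = 0)
    (hy : ∀ n < b, y.coeff n = 0) {n : ℤ} (hn : n < a + b) : (x * y).coeff n = 0 := by
  rw [laurent_coeff_mul hx hy, Finset.Icc_eq_empty (by omega), Finset.sum_empty]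

lemma laurent_C_mul_coeff (r : R) (x : LaurentSeries R) (n : ℤ) :
    (HahnSeries.C r * x).coeff n = r * x.coeff n := by
  rw [HahnSeries.C_mul_eq_smul]; simp

lemma laurent_natCast_mul_coeff (r : ℕ) (x : LaurentSeries R) (n : ℤ) :
    ((r : LaurentSeries R) * x).coeff n = r * x.coeff n := by
  rw [← map_natCast (HahnSeries.C (Γ := ℤ) (R := R)), laurent_C_mul_coeff]

lemma laurent_intCast_mul_coeff (r : ℤ) (x : LaurentSeries R) (n : ℤ) :
    ((r : LaurentSeries R) * x).coeff n = r * x.coeff n := by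
  rw [← map_intCast (HahnSeries.C (Γ := ℤ) (R := R)), laurent_C_mul_coeff]

/-- A Laurent series `q^d + O(q^{d+1})` is invertible. -/
lemma IsMonicAt.exists_inv [Nontrivial R] {x : LaurentSeries R} {d : ℤ} (hx : IsMonicAt x d) :
    ∃ y, x * y = 1 ∧ IsMonicAt y (-d) := by
  have h0 : x ≠ 0 := by rintro rfl; simpa using hx.2
  have ho : x.order = d := by
    refine le_antisymm (HahnSeries.order_le_of_coeff_ne_zero (by rw [hx.2]; exact one_ne_zero)) ?_
    by_contra h
    exact HahnSeries.coeff_order_eq_zero.not.mpr h0 (hx.1 _ (by omega))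
  have hl : x.leadingCoeff = 1 := by rw [HahnSeries.leadingCoeff_eq, ho, hx.2]
  have hu : IsUnit x := HahnSeries.isUnit_of_isUnit_leadingCoeff_AddUnitOrder
    (by rw [hl]; exact isUnit_one) (AddGroup.isAddUnit _)
  obtain ⟨y, hy⟩ := hu.exists_right_inv
  refine ⟨y, hy, ?_⟩
  have hy0 : y ≠ 0 := by rintro rfl; simp at hy
  have h1 : ∀ n < y.order, y.coeff n = 0 := fun _ hn => HahnSeries.coeff_eq_zero_of_lt_order hn
  have h2 := laurent_coeff_mul hx.1 h1 (d + y.order)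
  rw [show d + y.order - y.order = d by omega, Finset.Icc_self, Finset.sum_singleton, hx.2, one_mul,
    show d + y.order - d = y.order by omega, hy] at h2
  have h3 : d + y.order = 0 := by
    by_contra h
    rw [HahnSeries.coeff_one, if_neg h] at h2
    exact HahnSeries.coeff_order_eq_zero.not.mpr hy0 h2.symm
  have h4 : y.order = -d := by omega
  refine ⟨h4 ▸ h1, ?_⟩
  rw [h3] at h2
  rw [← h4, ← h2]; simp

/-- The Euler operator `q d/dq` on Laurent series. -/
def eulerOp (x : LaurentSeries R) : LaurentSeries R where
  coeff n := n * x.coeff n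
  isPWO_support' := x.isPWO_support.mono fun _ hn => right_ne_zero_of_mul hn

@[simp] lemma eulerOp_coeff (x : LaurentSeries R) (n : ℤ) :
    (eulerOp x).coeff n = n * x.coeff n := rfl

lemma eulerOp_mul (x y : LaurentSeries R) :
    eulerOp (x * y) = eulerOp x * y + x * eulerOp y := by
  obtain ⟨a, ha⟩ := laurent_exists_bound x
  obtain ⟨b, hb⟩ := laurent_exists_bound y
  ext n
  have ha' : ∀ n < a, (eulerOp x).coeff n = 0 := fun n hn => by simp [ha n hn]
  have hb' : ∀ n < b, (eulerOp y).coeff n = 0 := fun n hn => by simp [hb n hn]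
  rw [HahnSeries.coeff_add, laurent_coeff_mul ha' hb, laurent_coeff_mul ha hb', eulerOp_coeff,
    laurent_coeff_mul ha hb, ← Finset.sum_add_distrib, Finset.mul_sum]
  refine Finset.sum_congr rfl fun i _ => ?_
  simp only [eulerOp_coeff]; push_cast; ring

lemma eulerOp_pow (x : LaurentSeries R) (n : ℕ) :
    eulerOp (x ^ (n + 1)) = ((n + 1 : ℕ) : LaurentSeries R) * (x ^ n * eulerOp x) := by
  induction n with
  | zero => simp
  | succ n ih => rw [pow_succ, eulerOp_mul, ih]; push_cast; ring

/-- Coefficientwise application of a ring homomorphism. -/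
def laurentMap (f : R →+* S) : LaurentSeries R →+* LaurentSeries S where
  toFun x := x.map f
  map_one' := by
    ext n; simp only [HahnSeries.map_coeff, HahnSeries.coeff_one]; split_ifs <;> simp
  map_zero' := by ext n; simp
  map_add' x y := by ext n; simp
  map_mul' x y := by
    obtain ⟨a, ha⟩ := laurent_exists_bound x
    obtain ⟨b, hb⟩ := laurent_exists_bound y
    ext n
    rw [HahnSeries.map_coeff, laurent_coeff_mul ha hb, laurent_coeff_mul (a := a) (b := b)
      (fun n hn => by simp [ha n hn]) (fun n hn => by simp [hb n hn]), map_sum]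
    simp

@[simp] lemma laurentMap_coeff (f : R →+* S) (x : LaurentSeries R) (n : ℤ) :
    (laurentMap f x).coeff n = f (x.coeff n) := rfl

lemma IsMonicAt.map {x : LaurentSeries R} {d : ℤ} (hx : IsMonicAt x d) (f : R →+* S) :
    IsMonicAt (laurentMap f x) d :=
  ⟨fun n hn => by simp [hx.1 n hn], by simp [hx.2]⟩

/-- The substitution `q ↦ q^p` on Laurent series. -/
def laurentV (R : Type*) [CommRing R] (p : ℕ) [NeZero p] : LaurentSeries R →+* LaurentSeries R :=
  HahnSeries.embDomainRingHom (AddMonoidHom.mulLeft (p : ℤ))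
    (fun _ _ h => mul_left_cancel₀ (Nat.cast_ne_zero.mpr (NeZero.ne p)) h)
    (fun _ _ => mul_le_mul_iff_right₀ (Nat.cast_pos.mpr (NeZero.pos p)))

lemma laurentV_coeff_mul (p : ℕ) [NeZero p] (x : LaurentSeries R) (n : ℤ) :
    (laurentV R p x).coeff (p * n) = x.coeff n :=
  HahnSeries.embDomain_coeff (f := ⟨⟨_, _⟩, _⟩)

lemma laurentV_coeff_of_not_dvd (p : ℕ) [NeZero p] (x : LaurentSeries R) {n : ℤ}
    (h : ¬ (p : ℤ) ∣ n) : (laurentV R p x).coeff n = 0 := by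
  refine HahnSeries.embDomain_of_notMem_range (f := ⟨⟨_, _⟩, _⟩) ?_
  rintro ⟨m, hm⟩
  exact h ⟨m, hm.symm⟩

lemma laurentV_coeff (p : ℕ) [NeZero p] (x : LaurentSeries R) (n : ℤ) :
    (laurentV R p x).coeff n = if (p : ℤ) ∣ n then x.coeff (n / p) else 0 := by
  split_ifs with h
  · obtain ⟨m, rfl⟩ := h
    rw [laurentV_coeff_mul, Int.mul_ediv_cancel_left _ (Nat.cast_ne_zero.mpr (NeZero.ne p))]
  · exact laurentV_coeff_of_not_dvd p x h

lemma laurentMap_laurentV (f : R →+* S) (p : ℕ) [NeZero p] (x : LaurentSeries R) :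
    laurentMap f (laurentV R p x) = laurentV S p (laurentMap f x) := by
  ext n
  simp only [laurentMap_coeff, laurentV_coeff]
  split_ifs <;> simp

open Polynomial

/-- If `W = 1 + O(q)` and `J = q⁻¹ + O(1)` then every Laurent series agrees with some
`W * P(J)` up to `O(q)`. -/
lemma exists_polynomial_eval₂ {W J : LaurentSeries R} (hW : IsMonicAt W 0) (hJ : IsMonicAt J (-1))
    (d : ℕ) (s : LaurentSeries R) (hs : ∀ n < -(d : ℤ), s.coeff n = 0) :
    ∃ P : R[X], P.natDegree ≤ d ∧ ∀ n ≤ 0, (s - W * P.eval₂ HahnSeries.C J).coeff n = 0 := by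
  induction d generalizing s with
  | zero =>
    refine ⟨C (s.coeff 0), by simp, fun n hn => ?_⟩
    rw [eval₂_C, mul_comm, HahnSeries.coeff_sub, laurent_C_mul_coeff]
    rcases hn.lt_or_eq with h | rfl
    · rw [hs n (by simpa using h), hW.1 n h]; simp
    · rw [hW.2]; simp
  | succ d ih =>
    set c := s.coeff (-((d + 1 : ℕ) : ℤ)) with hc
    have hm : IsMonicAt (W * J ^ (d + 1)) (-((d + 1 : ℕ) : ℤ)) := by
      convert hW.mul (hJ.pow (d + 1)) using 1; push_cast; ring
    obtain ⟨P, hP, h⟩ := ih (s - HahnSeries.C c * (W * J ^ (d + 1))) fun n hn => by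
      rw [HahnSeries.coeff_sub, laurent_C_mul_coeff]
      rcases (show n ≤ -((d + 1 : ℕ) : ℤ) by push_cast; omega).lt_or_eq with h | rfl
      · rw [hs n h, hm.1 n h]; simp
      · rw [hm.2, hc]; simp
    refine ⟨P + C c * X ^ (d + 1), ?_, fun n hn => ?_⟩
    · refine (natDegree_add_le _ _).trans (max_le (hP.trans (by omega)) ?_)
      exact natDegree_C_mul_X_pow_le _ _
    · rw [← h n hn]
      congr 1
      rw [eval₂_add, eval₂_mul, eval₂_C, eval₂_pow, eval₂_X]
      ring

/-- If `W = 1 + O(q)`, `J = q⁻¹ + O(1)` and `W * P(J) = O(q)` then `P = 0`. -/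
lemma polynomial_eq_zero_of_eval₂ {W J : LaurentSeries R} (hW : IsMonicAt W 0)
    (hJ : IsMonicAt J (-1)) (P : R[X]) (h : ∀ n ≤ 0, (W * P.eval₂ HahnSeries.C J).coeff n = 0) :
    P = 0 := by
  rw [← leadingCoeff_eq_zero, leadingCoeff, ← h (-(P.natDegree : ℤ)) (by omega),
    eval₂_eq_sum_range, Finset.mul_sum]
  have hm (i : ℕ) : IsMonicAt (W * J ^ i) (-(i : ℤ)) := by
    convert hW.mul (hJ.pow i) using 1; ring
  have hz : (∑ i ∈ Finset.range (P.natDegree + 1),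
        W * (HahnSeries.C (P.coeff i) * J ^ i)).coeff (-(P.natDegree : ℤ))
      = ∑ i ∈ Finset.range (P.natDegree + 1),
          P.coeff i * (W * J ^ i).coeff (-(P.natDegree : ℤ)) := by
    rw [HahnSeries.coeff_sum]
    refine Finset.sum_congr rfl fun i _ => ?_
    rw [mul_left_comm, laurent_C_mul_coeff]
  rw [hz, Finset.sum_range_succ, (hm _).2, mul_one, Finset.sum_eq_zero, zero_add]
  intro i hi
  rw [(hm i).1 _ (by simp at hi; omega), mul_zero]

end Formal

section FormalCongruence

open Polynomial

/-- `f = q^{-m} + O(q)`. -/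
def IsPrincipal {R : Type*} [CommRing R] (f : LaurentSeries R) (m : ℕ) : Prop :=
  ∀ n ≤ 0, f.coeff n = if n = -(m : ℤ) then 1 else 0

lemma laurentMap_eval₂ {R S : Type*} [CommRing R] [CommRing S] (f : R →+* S)
    (J : LaurentSeries R) (P : R[X]) :
    laurentMap f (P.eval₂ HahnSeries.C J) = (P.map f).eval₂ HahnSeries.C (laurentMap f J) := by
  rw [hom_eval₂, eval₂_map]
  congr 1
  ext r n
  simp only [RingHom.comp_apply, laurentMap_coeff, HahnSeries.C_apply]
  by_cases h : n = 0
  · subst h; simp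
  · simp [HahnSeries.coeff_single_of_ne h]

lemma laurentV_eval₂ {R : Type*} [CommRing R] (p : ℕ) [NeZero p]
    (J : LaurentSeries R) (P : R[X]) :
    laurentV R p (P.eval₂ HahnSeries.C J) = P.eval₂ HahnSeries.C (laurentV R p J) := by
  rw [hom_eval₂]
  congr 1
  exact RingHom.ext fun r => HahnSeries.embDomainRingHom_C

lemma exists_eval₂_mul {R : Type*} [CommRing R] {J J' u : LaurentSeries R} {ρ Q P : R[X]}
    (hρ : J' = ρ.eval₂ HahnSeries.C J) (hQ : u * J' = Q.eval₂ HahnSeries.C J)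
    (hu : HahnSeries.C (P.coeff 0) * (u - 1) = 0) :
    ∃ T : R[X], u * P.eval₂ HahnSeries.C J' = T.eval₂ HahnSeries.C J := by
  refine ⟨Q * P.divX.comp ρ + C (P.coeff 0), ?_⟩
  conv_lhs => rw [← divX_mul_X_add P]
  rw [eval₂_add, eval₂_mul, eval₂_C, eval₂_X, eval₂_add, eval₂_mul, eval₂_C, eval₂_comp, ← hρ, ← hQ]
  linear_combination hu

/-- The comparison of `f_{pm}` with `f_m(q^p)` modulo `N`. -/
theorem principal_congruence {N p m : ℕ} [NeZero p] (hm : 0 < m) {N' : ℤ}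
    {W J : LaurentSeries ℤ} (hW : IsMonicAt W 0) (hJ : IsMonicAt J (-1))
    {P P' : ℤ[X]} (hP : IsPrincipal (W * P.eval₂ HahnSeries.C J) m)
    (hP' : IsPrincipal (W * P'.eval₂ HahnSeries.C J) (p * m))
    (hconst : ∀ i : ℕ, 0 < i → N' ∣ (W * J ^ i).coeff 0)
    {u : LaurentSeries (ZMod N)} {ρ Q : (ZMod N)[X]}
    (hVW : laurentV _ p (laurentMap (Int.castRingHom _) W) =
      laurentMap (Int.castRingHom _) W * u)
    (hρ : laurentV _ p (laurentMap (Int.castRingHom _) J) =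
      ρ.eval₂ HahnSeries.C (laurentMap (Int.castRingHom _) J))
    (hQ : u * laurentV _ p (laurentMap (Int.castRingHom _) J) =
      Q.eval₂ HahnSeries.C (laurentMap (Int.castRingHom _) J))
    (hu : (N' : LaurentSeries (ZMod N)) * (u - 1) = 0) (n : ℤ) :
    (N : ℤ) ∣ (W * P'.eval₂ HahnSeries.C J).coeff n -
      (laurentV ℤ p (W * P.eval₂ HahnSeries.C J)).coeff n := by
  have hP0 : N' ∣ P.coeff 0 := by
    have h0 := hP 0 le_rfl
    rw [if_neg (by omega), eval₂_eq_sum_range, Finset.mul_sum, HahnSeries.coeff_sum,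
      Finset.sum_range_succ'] at h0
    simp only [mul_left_comm W, laurent_C_mul_coeff, pow_zero, mul_one W] at h0
    rw [hW.2, mul_one] at h0
    rw [← eq_neg_iff_add_eq_zero] at h0
    rw [← dvd_neg, ← h0]
    exact Finset.dvd_sum fun i _ => (hconst (i + 1) i.succ_pos).mul_left _
  set φ := laurentMap (Int.castRingHom (ZMod N)) with hφ
  obtain ⟨T, hT⟩ := exists_eval₂_mul (P := P.map (Int.castRingHom (ZMod N))) hρ hQ (by
    obtain ⟨c, hc⟩ := hP0
    rw [coeff_map, hc, mul_comm N', map_mul, map_mul, mul_assoc, eq_intCast _ N',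
      map_intCast, hu, mul_zero])
  have key : φ (W * P'.eval₂ HahnSeries.C J - laurentV ℤ p (W * P.eval₂ HahnSeries.C J)) =
      φ W * (P'.map (Int.castRingHom (ZMod N)) - T).eval₂ HahnSeries.C (φ J) := by
    rw [map_sub, hφ, laurentMap_laurentV, map_mul, map_mul, map_mul, laurentMap_eval₂,
      laurentMap_eval₂, laurentV_eval₂, hVW, eval₂_sub, ← hT]
    ring
  have hz : P'.map (Int.castRingHom (ZMod N)) - T = 0 := by
    refine polynomial_eq_zero_of_eval₂ (hW.map (Int.castRingHom (ZMod N)))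
      (hJ.map (Int.castRingHom (ZMod N))) _ fun n hn => ?_
    rw [← hφ, ← key, hφ, laurentMap_coeff, HahnSeries.coeff_sub, hP' n hn, laurentV_coeff]
    split_ifs with h1 h2 h2
    · rw [hP _ (Int.ediv_le_of_le_mul (Nat.cast_pos.mpr (NeZero.pos p)) (by simpa)), if_pos,
        sub_self, map_zero]
      rw [h1, Nat.cast_mul, ← mul_neg,
        Int.mul_ediv_cancel_left _ (Nat.cast_ne_zero.mpr (NeZero.ne p))]
    · exact absurd ⟨-(m : ℤ), by rw [h1]; push_cast; ring⟩ h2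
    · rw [hP _ (Int.ediv_le_of_le_mul (Nat.cast_pos.mpr (NeZero.pos p)) (by simpa)), if_neg,
        sub_self, map_zero]
      intro h3
      obtain ⟨c, rfl⟩ := h2
      rw [Int.mul_ediv_cancel_left _ (Nat.cast_ne_zero.mpr (NeZero.ne p))] at h3
      exact h1 (by rw [h3]; push_cast; ring)
    · simp
  have := congrArg (fun s => s.coeff n) key
  simp only [hz, eval₂_zero, mul_zero, hφ, laurentMap_coeff, HahnSeries.coeff_sub,
    HahnSeries.coeff_zero] at this
  exact (ZMod.intCast_zmod_eq_zero_iff_dvd _ _).mp this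

/-- `q d/dq j = -j E₆ / E₄` forces the constant terms of `(E₆ / E₄) j ^ i` to vanish. -/
lemma coeff_zero_mul_pow_eq_zero {A A' B D J : LaurentSeries ℤ} (hA : A * A' = 1) (hD : D ≠ 0)
    (hJ : J * D = A ^ 3) (h : 3 * eulerOp A * D - A * eulerOp D = -(B * D)) {i : ℕ} (hi : 0 < i) :
    (B * A' * J ^ i).coeff 0 = 0 := by
  obtain ⟨i, rfl⟩ := Nat.exists_eq_succ_of_ne_zero hi.ne'
  have h1 : eulerOp J * D + J * eulerOp D = 3 * A ^ 2 * eulerOp A := by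
    rw [← eulerOp_mul, hJ, eulerOp_pow]; push_cast; ring
  have h2 : A * eulerOp J = -(J * B) := by
    refine mul_right_cancel₀ hD ?_
    linear_combination A * h1 + J * h + (-3 * eulerOp A) * hJ
  have h3 : eulerOp (J ^ (i + 1)) =
      -(((i + 1 : ℕ) : LaurentSeries ℤ) * (B * A' * J ^ (i + 1))) := by
    rw [eulerOp_pow]
    linear_combination (((i + 1 : ℕ) : LaurentSeries ℤ) * J ^ i) *
      (A' * h2 - eulerOp J * hA)
  have h4 := congrArg (fun s => s.coeff 0) h3
  simp only [eulerOp_coeff, HahnSeries.coeff_neg, laurent_natCast_mul_coeff] at h4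
  simpa [Nat.cast_add_one_ne_zero] using h4

end FormalCongruence

section EisensteinSeriesFormal

open Polynomial ArithmeticFunction

/-- `∑ σ_k(n) qⁿ`. -/
def divisorSeries (k : ℕ) : LaurentSeries ℤ :=
  HahnSeries.ofPowerSeries ℤ ℤ (PowerSeries.mk fun n => (sigma k n : ℤ))

/-- `(5 ∑ σ₃(n) qⁿ + 7 ∑ σ₅(n) qⁿ) / 12`. -/
def mixedDivisorSeries : LaurentSeries ℤ :=
  HahnSeries.ofPowerSeries ℤ ℤ (PowerSeries.mk fun n => (5 * sigma 3 n + 7 * sigma 5 n : ℤ) / 12)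

/-- The integral `q`-expansion of `E₄`. -/
def eis4 : LaurentSeries ℤ := 1 + 240 * divisorSeries 3

/-- The integral `q`-expansion of `E₆`. -/
def eis6 : LaurentSeries ℤ := 1 - 504 * divisorSeries 5

/-- The integral `q`-expansion of `Δ`. -/
def discSeries : LaurentSeries ℤ :=
  mixedDivisorSeries + 100 * divisorSeries 3 ^ 2 + 8000 * divisorSeries 3 ^ 3
    - 147 * divisorSeries 5 ^ 2

lemma ofPowerSeries_coeff_natCast {R : Type*} [CommRing R] (s : PowerSeries R) (n : ℕ) :
    (HahnSeries.ofPowerSeries ℤ R s).coeff n = PowerSeries.coeff n s :=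
  HahnSeries.ofPowerSeries_apply_coeff s n

lemma ofPowerSeries_coeff_of_neg {R : Type*} [CommRing R] (s : PowerSeries R) {n : ℤ} (hn : n < 0) :
    (HahnSeries.ofPowerSeries ℤ R s).coeff n = 0 := by
  rw [HahnSeries.ofPowerSeries_apply]
  refine HahnSeries.embDomain_of_notMem_range ?_
  rintro ⟨m, rfl⟩
  simp at hn
  omega

lemma twelve_mul_mixedDivisorSeries :
    12 * mixedDivisorSeries = 5 * divisorSeries 3 + 7 * divisorSeries 5 := by
  have h : (12 : PowerSeries ℤ) *
      (PowerSeries.mk fun n => (5 * sigma 3 n + 7 * sigma 5 n : ℤ) / 12) =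
      5 * (PowerSeries.mk fun n => (sigma 3 n : ℤ)) +
        7 * PowerSeries.mk fun n => (sigma 5 n : ℤ) := by
    ext n
    rw [map_add, ← map_ofNat (PowerSeries.C (R := ℤ)) 12, ← map_ofNat (PowerSeries.C (R := ℤ)) 5,
      ← map_ofNat (PowerSeries.C (R := ℤ)) 7]
    simp only [PowerSeries.coeff_C_mul, PowerSeries.coeff_mk]
    refine Int.mul_ediv_cancel' ?_
    have hd (d : ℤ) : (12 : ℤ) ∣ 5 * d ^ 3 + 7 * d ^ 5 := by
      rw [← Nat.cast_ofNat, ← ZMod.intCast_zmod_eq_zero_iff_dvd]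
      push_cast
      generalize (d : ZMod 12) = e
      revert e
      decide
    rw [sigma_apply, sigma_apply]
    push_cast
    rw [Finset.mul_sum, Finset.mul_sum, ← Finset.sum_add_distrib]
    exact Finset.dvd_sum fun d _ => hd d
  have h' := congrArg (HahnSeries.ofPowerSeries ℤ ℤ) h
  rw [map_mul, map_add, map_mul, map_mul, map_ofNat, map_ofNat, map_ofNat] at h'
  exact h'

lemma discSeries_eq : 1728 * discSeries = eis4 ^ 3 - eis6 ^ 2 := by
  rw [discSeries, eis4, eis6]
  linear_combination 144 * twelve_mul_mixedDivisorSeries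

lemma isMonicAt_ofPowerSeries {R : Type*} [CommRing R] {s : PowerSeries R}
    (h0 : PowerSeries.coeff 0 s = 0)
    (h1 : PowerSeries.coeff 1 s = 1) : IsMonicAt (HahnSeries.ofPowerSeries ℤ R s) 1 := by
  refine ⟨fun n hn => ?_, ?_⟩
  · rcases (show n ≤ 0 by omega).lt_or_eq with h | rfl
    · exact ofPowerSeries_coeff_of_neg s h
    · rw [← h0]; exact ofPowerSeries_coeff_natCast s 0
  · rw [← h1]; exact ofPowerSeries_coeff_natCast s 1

lemma isMonicAt_divisorSeries (k : ℕ) : IsMonicAt (divisorSeries k) 1 :=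
  isMonicAt_ofPowerSeries (by simp) (by simp)

lemma laurent_ofNat_mul_coeff {R : Type*} [CommRing R] (r : ℕ) [r.AtLeastTwo] (x : LaurentSeries R)
    (n : ℤ) : ((OfNat.ofNat r : LaurentSeries R) * x).coeff n = OfNat.ofNat r * x.coeff n := by
  rw [← Nat.cast_ofNat, laurent_natCast_mul_coeff, Nat.cast_ofNat]

lemma isMonicAt_eis4 : IsMonicAt eis4 0 := by
  have h := (isMonicAt_divisorSeries 3).1
  refine ⟨fun n hn => ?_, ?_⟩
  · rw [eis4, HahnSeries.coeff_add, laurent_ofNat_mul_coeff, h n (by omega), isMonicAt_one.1 n hn]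
    simp
  · rw [eis4, HahnSeries.coeff_add, laurent_ofNat_mul_coeff, h 0 (by omega), isMonicAt_one.2]
    simp

lemma isMonicAt_eis6 : IsMonicAt eis6 0 := by
  have h := (isMonicAt_divisorSeries 5).1
  refine ⟨fun n hn => ?_, ?_⟩
  · rw [eis6, HahnSeries.coeff_sub, laurent_ofNat_mul_coeff, h n (by omega), isMonicAt_one.1 n hn]
    simp
  · rw [eis6, HahnSeries.coeff_sub, laurent_ofNat_mul_coeff, h 0 (by omega), isMonicAt_one.2]
    simp

lemma isMonicAt_discSeries : IsMonicAt discSeries 1 := by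
  have h : IsMonicAt mixedDivisorSeries 1 := isMonicAt_ofPowerSeries (by simp) (by simp)
  have h2 := ((isMonicAt_divisorSeries 3).pow 2).1
  have h3 := ((isMonicAt_divisorSeries 3).pow 3).1
  have h4 := ((isMonicAt_divisorSeries 5).pow 2).1
  have key : ∀ n < 2, discSeries.coeff n = mixedDivisorSeries.coeff n := fun n hn => by
    rw [discSeries, HahnSeries.coeff_sub, HahnSeries.coeff_add, HahnSeries.coeff_add,
      laurent_ofNat_mul_coeff, laurent_ofNat_mul_coeff, laurent_ofNat_mul_coeff,
      h2 n (by push_cast; omega),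
      h3 n (by push_cast; omega), h4 n (by push_cast; omega)]
    simp
  exact ⟨fun n hn => by rw [key n (by omega), h.1 n hn], by rw [key 1 (by omega), h.2]⟩

/-- The inverse of `E₄`. -/
def eis4Inv : LaurentSeries ℤ := isMonicAt_eis4.exists_inv.choose

lemma eis4_mul_eis4Inv : eis4 * eis4Inv = 1 := isMonicAt_eis4.exists_inv.choose_spec.1

/-- The `q`-expansion of the `j`-invariant. -/
def jSeries : LaurentSeries ℤ := eis4 ^ 3 * isMonicAt_discSeries.exists_inv.choose

lemma jSeries_mul_discSeries : jSeries * discSeries = eis4 ^ 3 := by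
  rw [jSeries, mul_assoc, mul_comm _ discSeries, isMonicAt_discSeries.exists_inv.choose_spec.1,
    mul_one]

lemma isMonicAt_jSeries : IsMonicAt jSeries (-1) :=
  (isMonicAt_eis4.pow 3).mul isMonicAt_discSeries.exists_inv.choose_spec.2

/-- `E₄ ^ a * E₆ ^ b`. -/
def eisMonomial (a b : ℕ) : LaurentSeries ℤ := eis4 ^ a * eis6 ^ b

lemma isMonicAt_eisMonomial (a b : ℕ) : IsMonicAt (eisMonomial a b) 0 := by
  have h := (isMonicAt_eis4.pow a).mul (isMonicAt_eis6.pow b)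
  rwa [mul_zero, mul_zero, add_zero] at h

/-- The constant terms of `W * j ^ i` are divisible by `c` if `W ≡ E₆ / E₄` modulo `c`. -/
lemma dvd_coeff_zero_mul_jSeries_pow
    (hR : 3 * eulerOp eis4 * discSeries - eis4 * eulerOp discSeries = -(eis6 * discSeries))
    {W : LaurentSeries ℤ} {c : ℤ} (h : (c : LaurentSeries ℤ) ∣ W * eis4 - eis6) {i : ℕ}
    (hi : 0 < i) : c ∣ (W * jSeries ^ i).coeff 0 := by
  obtain ⟨z, hz⟩ := h
  have h0 : discSeries ≠ 0 := fun h => by simpa [h] using isMonicAt_discSeries.2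
  have : W * jSeries ^ i = eis6 * eis4Inv * jSeries ^ i + c * (z * eis4Inv * jSeries ^ i) := by
    linear_combination eis4Inv * jSeries ^ i * hz - W * jSeries ^ i * eis4_mul_eis4Inv
  rw [this, HahnSeries.coeff_add, laurent_intCast_mul_coeff,
    coeff_zero_mul_pow_eq_zero eis4_mul_eis4Inv h0 jSeries_mul_discSeries hR hi, zero_add]
  exact dvd_mul_right _ _

/-- The modulus to which `E₄ ^ a * E₆ ^ b` agrees with `E₆ / E₄`. -/
def weightModulus (k : ℕ) : ℤ :=
  if k = 4 then 24 else if k = 6 then 240 else if k = 8 then 72 else if k = 10 then 480 else 720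

/-- The pairs `(a, b)` with `4 a + 6 b = k`. -/
def IsWeightPair (k a b : ℕ) : Prop :=
  (k = 4 ∧ a = 1 ∧ b = 0) ∨ (k = 6 ∧ a = 0 ∧ b = 1) ∨ (k = 8 ∧ a = 2 ∧ b = 0) ∨
    (k = 10 ∧ a = 1 ∧ b = 1) ∨ (k = 14 ∧ a = 2 ∧ b = 1)

lemma weightModulus_dvd {k a b : ℕ} (h : IsWeightPair k a b) :
    (weightModulus k : LaurentSeries ℤ) ∣ eisMonomial a b * eis4 - eis6 := by
  rcases h with ⟨rfl, rfl, rfl⟩ | ⟨rfl, rfl, rfl⟩ | ⟨rfl, rfl, rfl⟩ |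
      ⟨rfl, rfl, rfl⟩ | ⟨rfl, rfl, rfl⟩ <;>
    simp only [eisMonomial, weightModulus, eis4, eis6] <;> norm_num
  · exact ⟨20 * divisorSeries 3 + 2400 * divisorSeries 3 ^ 2 + 21 * divisorSeries 5, by ring⟩
  · exact ⟨divisorSeries 3 * (1 - 504 * divisorSeries 5), by ring⟩
  · exact ⟨10 * divisorSeries 3 + 2400 * divisorSeries 3 ^ 2 + 192000 * divisorSeries 3 ^ 3
      + 7 * divisorSeries 5, by ring⟩
  · exact ⟨(divisorSeries 3 + 120 * divisorSeries 3 ^ 2) * (1 - 504 * divisorSeries 5), by ring⟩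
  · exact ⟨(divisorSeries 3 + 240 * divisorSeries 3 ^ 2 + 19200 * divisorSeries 3 ^ 3) *
      (1 - 504 * divisorSeries 5), by ring⟩

end EisensteinSeriesFormal

section Reductions

open Polynomial

/-- The series `β` with `E₄(q) = β + 256 γ`, `E₄(q²) = β + 16 γ`. -/
def betaTwo : LaurentSeries ℤ := 1 + 256 * laurentV ℤ 2 (divisorSeries 3) - 16 * divisorSeries 3

/-- The series `β` with `E₄(q) = β + 243 γ`, `E₄(q³) = β + 3 γ`. -/
def betaThree : LaurentSeries ℤ := 1 + 243 * laurentV ℤ 3 (divisorSeries 3) - 3 * divisorSeries 3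

/-- `(E₄(q) - E₄(q^p)) / 240`. -/
def gammaSeries (p : ℕ) [NeZero p] : LaurentSeries ℤ :=
  divisorSeries 3 - laurentV ℤ p (divisorSeries 3)

lemma laurentV_eis4_two : laurentV ℤ 2 eis4 = betaTwo + 16 * gammaSeries 2 := by
  rw [betaTwo, gammaSeries, eis4]
  simp only [map_add, map_mul, map_one, map_ofNat]; ring

lemma laurentV_eis4_three : laurentV ℤ 3 eis4 = betaThree + 3 * gammaSeries 3 := by
  rw [betaThree, gammaSeries, eis4]
  simp only [map_add, map_mul, map_one, map_ofNat]; ring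

/-- The relations between modular forms of level 2. -/
structure LevelTwoRelations : Prop where
  disc : betaTwo ^ 2 * gammaSeries 2 = discSeries
  disc_V : betaTwo * gammaSeries 2 ^ 2 = laurentV ℤ 2 discSeries
  eis6 : eis6 * (betaTwo - 8 * gammaSeries 2) =
    laurentV ℤ 2 eis6 * (betaTwo - 512 * gammaSeries 2)

/-- The relations between modular forms of level 3. -/
structure LevelThreeRelations : Prop where
  disc : betaThree ^ 3 * gammaSeries 3 = (betaThree + 27 * gammaSeries 3) * discSeries
  disc_V : betaThree * gammaSeries 3 ^ 3 =
    (betaThree + 27 * gammaSeries 3) * laurentV ℤ 3 discSeries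
  eis6 : eis6 * (betaThree ^ 2 + 18 * betaThree * gammaSeries 3 - 27 * gammaSeries 3 ^ 2) =
    laurentV ℤ 3 eis6 *
      (betaThree ^ 2 - 486 * betaThree * gammaSeries 3 - 19683 * gammaSeries 3 ^ 2)

/-- Reductions at `2`, with `x = γ / β`. -/
lemma level_two_algebra {S : Type*} [CommRing S] (h256 : (256 : S) = 0)
    {A A' VA B VB D VD J VJ β γ : S} (hA' : A * A' = 1) (hJ : J * D = A ^ 3)
    (hVJ : VJ * VD = VA ^ 3) (hA : A = β + 256 * γ) (hVA : VA = β + 16 * γ)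
    (h1 : β ^ 2 * γ = D) (h2 : β * γ ^ 2 = VD)
    (h3 : B * (β - 8 * γ) = VB * (β - 512 * γ)) :
    ∃ x, J * x = 1 ∧ VA = A * (1 + 16 * x) ∧ VB = B * (1 - 8 * x) ∧ VJ = J ^ 2 + 48 * J := by
  obtain rfl : A = β := by rw [hA, h256]; ring
  have hγ : γ = A * (A' * γ) := by linear_combination -γ * hA'
  generalize A' * γ = x at hγ
  subst hγ
  have hpow : A ^ 3 * A' ^ 3 = 1 := by rw [← mul_pow, hA', one_pow]
  have hx : J * x = 1 := by
    linear_combination A' ^ 3 * hJ + (1 - J * x) * hpow + A' ^ 3 * J * h1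
  have hx2 : VJ * x ^ 2 = (1 + 16 * x) ^ 3 := by
    rw [hVA] at hVJ
    linear_combination A' ^ 3 * hVJ + ((1 + 16 * x) ^ 3 - VJ * x ^ 2) * hpow + A' ^ 3 * VJ * h2
  refine ⟨x, hx, by rw [hVA]; ring, ?_, ?_⟩
  · linear_combination -A' * h3 + (B * (1 - 8 * x) - VB * (1 - 512 * x)) * hA' + 2 * VB * x * h256
  · linear_combination J ^ 2 * hx2
      + (-VJ * (1 + J * x) + 48 * J + (3 + 16 * x) * 256 * (1 + J * x)) * hx
      + (3 + 16 * x) * h256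

/-- Reductions at `3`, with `x = γ / β`. -/
lemma level_three_algebra {S : Type*} [CommRing S] (h27 : (27 : S) = 0)
    {A A' VA B VB D VD J VJ β γ : S} (hA' : A * A' = 1) (hJ : J * D = A ^ 3)
    (hVJ : VJ * VD = VA ^ 3) (hA : A = β + 243 * γ) (hVA : VA = β + 3 * γ)
    (h1 : β ^ 3 * γ = (β + 27 * γ) * D) (h2 : β * γ ^ 3 = (β + 27 * γ) * VD)
    (h3 : B * (β ^ 2 + 18 * β * γ - 27 * γ ^ 2) = VB * (β ^ 2 - 486 * β * γ - 19683 * γ ^ 2)) :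
    ∃ x, J * x = 1 ∧ VA = A * (1 + 3 * x) ∧ VB = B * (1 + 18 * x) ∧ VJ = J ^ 3 + 9 * J ^ 2 := by
  obtain rfl : A = β := by rw [hA]; linear_combination 9 * γ * h27
  have hγ : γ = A * (A' * γ) := by linear_combination -γ * hA'
  generalize A' * γ = x at hγ
  subst hγ
  have hpow (n : ℕ) : A ^ n * A' ^ n = 1 := by rw [← mul_pow, hA', one_pow]
  have hD : D = A ^ 3 * x := by
    linear_combination -A' * h1 - (D - A ^ 3 * x) * hA' - A * A' * x * D * h27
  have hVD : VD = A ^ 3 * x ^ 3 := by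
    linear_combination -A' * h2 - (VD - A ^ 3 * x ^ 3) * hA' - A * A' * x * VD * h27
  have hx : J * x = 1 := by
    rw [hD] at hJ
    linear_combination A' ^ 3 * hJ + (1 - J * x) * hpow 3
  have hx2 : VJ * x ^ 3 = (1 + 3 * x) ^ 3 := by
    rw [hVD, hVA] at hVJ
    linear_combination A' ^ 3 * hVJ + ((1 + 3 * x) ^ 3 - VJ * x ^ 3) * hpow 3
  have hx3 : J ^ 3 * x ^ 3 = 1 := by rw [← mul_pow, hx, one_pow]
  refine ⟨x, hx, by rw [hVA]; ring, ?_, ?_⟩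
  · linear_combination -A' ^ 2 * h3 + (B * (1 + 18 * x - 27 * x ^ 2)
      - VB * (1 - 486 * x - 19683 * x ^ 2)) * hpow 2
      + (18 * x * VB + 729 * x ^ 2 * VB - B * x ^ 2) * h27
  · linear_combination J ^ 3 * hx2 - VJ * hx3 + 9 * J ^ 2 * hx
      + (J ^ 3 * x ^ 2 + J ^ 3 * x ^ 3) * h27

/-- Reductions at `5`, with `x = 1 / j`. -/
lemma level_five_algebra {S : Type*} [CommRing S] (h5 : (5 : S) = 0)
    {A B VB D VD J VJ a : S} (hJ : J * D = A ^ 3) (hVJ : VJ * VD = 1) (hA : A = 1 + 240 * a)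
    (hD : 1728 * D = A ^ 3 - B ^ 2) (hVD : VD = D ^ 5) (hVB : VB = B ^ 5) :
    J * D = 1 ∧ VB = B * (1 - 3 * D) ^ 2 ∧ VJ = J ^ 5 := by
  obtain rfl : A = 1 := by linear_combination hA + 48 * a * h5
  have hx : J * D = 1 := by linear_combination hJ
  have hx5 : J ^ 5 * D ^ 5 = 1 := by rw [← mul_pow, hx, one_pow]
  have hB : B ^ 2 = 1 - 3 * D := by linear_combination hD - 345 * D * h5
  refine ⟨hx, ?_, ?_⟩
  · rw [hVB, ← hB]; ring
  · rw [hVD] at hVJ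
    linear_combination J ^ 5 * hVJ - VJ * hx5

/-- The data needed to compare `W * P(j)` and its image under `q ↦ q^p` modulo `N`. -/
def HasReduction (N p : ℕ) [NeZero p] (c : ℤ) (W : LaurentSeries ℤ) : Prop :=
  ∃ (u : LaurentSeries (ZMod N)) (ρ Q : (ZMod N)[X]),
    laurentV _ p (laurentMap (Int.castRingHom _) W) = laurentMap (Int.castRingHom _) W * u ∧
    laurentV _ p (laurentMap (Int.castRingHom _) jSeries) =
      ρ.eval₂ HahnSeries.C (laurentMap (Int.castRingHom _) jSeries) ∧
    u * laurentV _ p (laurentMap (Int.castRingHom _) jSeries) =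
      Q.eval₂ HahnSeries.C (laurentMap (Int.castRingHom _) jSeries) ∧
    (c : LaurentSeries (ZMod N)) * (u - 1) = 0

/-- Reduction of integral Laurent series modulo `N`. -/
abbrev laurentMod (N : ℕ) : LaurentSeries ℤ →+* LaurentSeries (ZMod N) :=
  laurentMap (Int.castRingHom (ZMod N))

lemma laurent_natCast_self (N : ℕ) : (N : LaurentSeries (ZMod N)) = 0 := by
  rw [← map_natCast (HahnSeries.C (Γ := ℤ) (R := ZMod N)), ZMod.natCast_self, map_zero]

lemma laurentMod_jSeries_mul (N : ℕ) :
    laurentMod N jSeries * laurentMod N discSeries = laurentMod N eis4 ^ 3 := by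
  rw [← map_mul, jSeries_mul_discSeries, map_pow]

lemma laurentMod_V_jSeries_mul (N p : ℕ) [NeZero p] :
    laurentV _ p (laurentMod N jSeries) * laurentMod N (laurentV ℤ p discSeries) =
      laurentMod N (laurentV ℤ p eis4) ^ 3 := by
  rw [laurentMap_laurentV, laurentMap_laurentV, ← map_mul, laurentMod_jSeries_mul, map_pow]

lemma hasReduction_two (h : LevelTwoRelations) {k a b : ℕ} (hk : IsWeightPair k a b) :
    HasReduction (2 ^ eps k 2) 2 (weightModulus k) (eisMonomial a b) := by
  set N := 2 ^ eps k 2 with hN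
  have h0 := laurent_natCast_self N
  have h256 : (256 : LaurentSeries (ZMod N)) = 0 := by
    obtain ⟨c, hc⟩ : N ∣ 256 := by
      rw [hN]; simp only [eps]; split_ifs <;> norm_num
    calc (256 : LaurentSeries (ZMod N)) = ((256 : ℕ) : LaurentSeries (ZMod N)) := by simp
      _ = 0 := by rw [hc, Nat.cast_mul, h0, zero_mul]
  obtain ⟨x, hx, hVA, hVB, hVJ⟩ := level_two_algebra h256 (A' := laurentMod N eis4Inv)
    (β := laurentMod N betaTwo) (γ := laurentMod N (gammaSeries 2))
    (by rw [← map_mul, eis4_mul_eis4Inv, map_one])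
    (laurentMod_jSeries_mul N) (laurentMod_V_jSeries_mul N 2)
    (by rw [← map_ofNat (laurentMod N) 256, ← map_mul, ← map_add, betaTwo, gammaSeries, eis4]
        congr 1; ring)
    (by rw [← map_ofNat (laurentMod N) 16, ← map_mul, ← map_add, laurentV_eis4_two])
    (by rw [← h.disc, map_mul, map_pow])
    (by rw [← h.disc_V, map_mul, map_pow])
    (by simpa only [map_sub, map_mul, map_ofNat] using congrArg (laurentMod N) h.eis6)
  rw [laurentMap_laurentV] at hVA hVB
  have hW : laurentV _ 2 (laurentMod N (eisMonomial a b)) =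
      laurentMod N (eisMonomial a b) * ((1 + 16 * x) ^ a * (1 - 8 * x) ^ b) := by
    simp only [eisMonomial, map_mul, map_pow, hVA, hVB, mul_pow]; ring
  rcases hk with ⟨rfl, rfl, rfl⟩ | ⟨rfl, rfl, rfl⟩ | ⟨rfl, rfl, rfl⟩ |
      ⟨rfl, rfl, rfl⟩ | ⟨rfl, rfl, rfl⟩
  all_goals
    simp only [hN, eps, ↓reduceIte, true_or, or_true, Nat.reduceEqDiff,
      or_self] at h0
    push_cast at h0
  · refine ⟨_, X ^ 2 + 48 * X, X ^ 2 + 64 * X, hW, ?_, ?_, ?_⟩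
    · simp [eval₂_add, eval₂_mul, hVJ]
    · simp [hVJ]
      linear_combination (16 * laurentMod N jSeries + 768) * hx + 6 * h0
    · simp [weightModulus]
      linear_combination 3 * x * h0
  · refine ⟨_, X ^ 2 + 48 * X, X ^ 2 + 40 * X, hW, ?_, ?_, ?_⟩
    · simp [hVJ]
    · simp [hVJ]
      linear_combination (-8 * laurentMod N jSeries - 384) * hx - 3 * h0
    · simp [weightModulus]
      linear_combination 15 * x * h0
  · refine ⟨_, X ^ 2 + 48 * X, X ^ 2 + 80 * X, hW, ?_, ?_, ?_⟩
    · simp [hVJ]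
    · simp [hVJ]
      linear_combination (32 * laurentMod N jSeries + 1536) * hx + 6 * h0
        + x ^ 2 * (laurentMod N jSeries ^ 2 + 48 * laurentMod N jSeries) * h0
    · simp [weightModulus]
      linear_combination (9 * x + 72 * x ^ 2) * h0
  · refine ⟨_, X ^ 2 + 48 * X, X ^ 2 + 56 * X, hW, ?_, ?_, ?_⟩
    · simp [hVJ]
    · simp [hVJ]
      linear_combination (8 * laurentMod N jSeries + 384) * hx
        - 128 * (laurentMod N jSeries * x + 1) * hx - 6144 * x * hx + (1 - 24 * x) * h0
    · simp [weightModulus]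
      linear_combination (15 * x - 240 * x ^ 2) * h0
  · refine ⟨_, X ^ 2 + 48 * X, X ^ 2 + 72 * X, hW, ?_, ?_, ?_⟩
    · simp [hVJ]
    · simp [hVJ]
      linear_combination (24 * laurentMod N jSeries + 1152) * hx + 9 * h0
        - 16 * x ^ 3 * (laurentMod N jSeries ^ 2 + 48 * laurentMod N jSeries) * h0
    · simp [weightModulus]
      linear_combination (135 * x - 11520 * x ^ 3) * h0



lemma hasReduction_three (h : LevelThreeRelations) {k a b : ℕ} (hk : IsWeightPair k a b) :
    HasReduction (3 ^ eps k 3) 3 (weightModulus k) (eisMonomial a b) := by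
  set N := 3 ^ eps k 3 with hN
  have h0 := laurent_natCast_self N
  have h27 : (27 : LaurentSeries (ZMod N)) = 0 := by
    obtain ⟨c, hc⟩ : N ∣ 27 := by
      rw [hN]; norm_num [eps]; split_ifs <;> norm_num
    calc (27 : LaurentSeries (ZMod N)) = ((27 : ℕ) : LaurentSeries (ZMod N)) := by simp
      _ = 0 := by rw [hc, Nat.cast_mul, h0, zero_mul]
  obtain ⟨x, hx, hVA, hVB, hVJ⟩ := level_three_algebra h27 (A' := laurentMod N eis4Inv)
    (β := laurentMod N betaThree) (γ := laurentMod N (gammaSeries 3))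
    (by rw [← map_mul, eis4_mul_eis4Inv, map_one])
    (laurentMod_jSeries_mul N) (laurentMod_V_jSeries_mul N 3)
    (by rw [← map_ofNat (laurentMod N) 243, ← map_mul, ← map_add, betaThree, gammaSeries, eis4]
        congr 1; ring)
    (by rw [← map_ofNat (laurentMod N) 3, ← map_mul, ← map_add, laurentV_eis4_three])
    (by simpa only [map_sub, map_add, map_mul, map_ofNat, map_pow]
          using congrArg (laurentMod N) h.disc)
    (by simpa only [map_sub, map_add, map_mul, map_ofNat, map_pow]
          using congrArg (laurentMod N) h.disc_V)
    (by simpa only [map_sub, map_add, map_mul, map_ofNat, map_pow]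
          using congrArg (laurentMod N) h.eis6)
  rw [laurentMap_laurentV] at hVA hVB
  have hW : laurentV _ 3 (laurentMod N (eisMonomial a b)) =
      laurentMod N (eisMonomial a b) * ((1 + 3 * x) ^ a * (1 + 18 * x) ^ b) := by
    simp only [eisMonomial, map_mul, map_pow, hVA, hVB, mul_pow]; ring
  rcases hk with ⟨rfl, rfl, rfl⟩ | ⟨rfl, rfl, rfl⟩ | ⟨rfl, rfl, rfl⟩ |
      ⟨rfl, rfl, rfl⟩ | ⟨rfl, rfl, rfl⟩
  all_goals
    simp only [hN, eps, ↓reduceIte, true_or, or_true, Nat.reduceEqDiff,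
      or_self] at h0
    push_cast at h0
  · refine ⟨_, X ^ 3 + 9 * X ^ 2, X ^ 3 + 3 * X ^ 2, hW, ?_, ?_, ?_⟩
    · simp [hVJ]
    · simp [hVJ]
      generalize laurentMod N jSeries = J at *
      linear_combination (3 * J ^ 2 + 27 * J) * hx + (J ^ 2 + 3 * J) * h0
    · simp [weightModulus]
      linear_combination 8 * x * h0
  · refine ⟨_, X ^ 3 + 9 * X ^ 2, X ^ 3, hW, ?_, ?_, ?_⟩
    · simp [hVJ]
    · simp [hVJ]
      generalize laurentMod N jSeries = J at *
      linear_combination (18 * J ^ 2 + 162 * J) * hx + (J ^ 2 + 6 * J) * h0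
    · simp [weightModulus]
      linear_combination 160 * x * h0
  · refine ⟨_, X ^ 3 + 9 * X ^ 2, X ^ 3 + 15 * X ^ 2 + 9 * X, hW, ?_, ?_, ?_⟩
    · simp [hVJ]
    · simp [hVJ]
      generalize laurentMod N jSeries = J at *
      linear_combination (6 * J ^ 2 + 54 * J) * hx + (9 * J + 81) * (J * x + 1) * hx
        + (2 * J + 3) * h0
    · simp [weightModulus]
      linear_combination (16 * x + 24 * x ^ 2) * h0
  · refine ⟨_, X ^ 3 + 9 * X ^ 2, X ^ 3 + 3 * X ^ 2, hW, ?_, ?_, ?_⟩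
    · simp [hVJ]
    · simp [hVJ]
      generalize laurentMod N jSeries = J at *
      linear_combination (3 * J ^ 2 + 27 * J) * hx
        + ((J ^ 2 + 3 * J) + (2 * x + 6 * x ^ 2) * (J ^ 3 + 9 * J ^ 2)) * h0
    · simp [weightModulus]
      linear_combination (1120 * x + 2880 * x ^ 2) * h0
  · refine ⟨_, X ^ 3 + 9 * X ^ 2, X ^ 3 + 33 * X ^ 2 + 9 * X, hW, ?_, ?_, ?_⟩
    · simp [hVJ]
    · simp [hVJ]
      generalize laurentMod N jSeries = J at *
      linear_combination (24 * J ^ 2 + 216 * J) * hx + (9 * J + 81) * (J * x + 1) * hx +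
        ((8 * J + 3) + (4 * x ^ 2 + 6 * x ^ 3) * (J ^ 3 + 9 * J ^ 2)) * h0
    · simp [weightModulus]
      linear_combination (640 * x + 3120 * x ^ 2 + 4320 * x ^ 3) * h0

/-- Frobenius on Laurent series coming from power series over `𝔽_p`. -/
lemma laurentV_ofPowerSeries_zmod (p : ℕ) [Fact p.Prime] (s : PowerSeries (ZMod p)) :
    laurentV (ZMod p) p (HahnSeries.ofPowerSeries ℤ (ZMod p) s) =
      HahnSeries.ofPowerSeries ℤ (ZMod p) s ^ p := by
  have hp0 : p ≠ 0 := NeZero.ne p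
  have h : PowerSeries.expand p hp0 s = s ^ p := by
    have := MvPowerSeries.map_frobenius_expand p hp0 (f := s)
    rwa [ZMod.frobenius_zmod, MvPowerSeries.map_id] at this
  rw [← map_pow, ← h]
  ext n
  rw [laurentV_coeff]
  rcases lt_or_ge n 0 with hn | hn
  · rw [ofPowerSeries_coeff_of_neg _ hn]
    split_ifs with hd
    · obtain ⟨m, rfl⟩ := hd
      rw [Int.mul_ediv_cancel_left _ (Nat.cast_ne_zero.mpr hp0), ofPowerSeries_coeff_of_neg]
      exact neg_of_mul_neg_right hn (by positivity)
    · rfl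
  · lift n to ℕ using hn
    rw [ofPowerSeries_coeff_natCast, PowerSeries.coeff_expand, ← Int.natCast_div,
      ofPowerSeries_coeff_natCast]
    simp only [Int.natCast_dvd_natCast]

lemma hasReduction_five {k a b : ℕ} (hk : IsWeightPair k a b) :
    HasReduction (5 ^ eps k 5) 5 (weightModulus k) (eisMonomial a b) := by
  have : Fact (Nat.Prime 5) := ⟨by norm_num⟩
  have he : 5 ^ eps k 5 = 5 := by simp [eps]
  rw [he]
  have h5 : (5 : LaurentSeries (ZMod 5)) = 0 := laurent_natCast_self 5
  have hfrob (s : PowerSeries ℤ) : laurentV _ 5 (laurentMod 5 (HahnSeries.ofPowerSeries ℤ ℤ s)) =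
      laurentMod 5 (HahnSeries.ofPowerSeries ℤ ℤ s) ^ 5 := by
    have : laurentMod 5 (HahnSeries.ofPowerSeries ℤ ℤ s) =
        HahnSeries.ofPowerSeries ℤ (ZMod 5) (s.map (Int.castRingHom _)) := by
      ext n
      rw [laurentMap_coeff]
      rcases lt_or_ge n 0 with hn | hn
      · rw [ofPowerSeries_coeff_of_neg _ hn, ofPowerSeries_coeff_of_neg _ hn, map_zero]
      · lift n to ℕ using hn
        rw [ofPowerSeries_coeff_natCast, ofPowerSeries_coeff_natCast, PowerSeries.coeff_map]
    rw [this, laurentV_ofPowerSeries_zmod]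
  have hfrob6 : laurentV _ 5 (laurentMod 5 eis6) = laurentMod 5 eis6 ^ 5 := by
    have := hfrob (1 - 504 * PowerSeries.mk fun n => (ArithmeticFunction.sigma 5 n : ℤ))
    rw [map_sub, map_mul, map_one, map_ofNat] at this
    exact this
  have hfrobD : laurentV _ 5 (laurentMod 5 discSeries) = laurentMod 5 discSeries ^ 5 := by
    have := hfrob ((PowerSeries.mk fun n =>
        (5 * ArithmeticFunction.sigma 3 n + 7 * ArithmeticFunction.sigma 5 n : ℤ) / 12)
      + 100 * (PowerSeries.mk fun n => (ArithmeticFunction.sigma 3 n : ℤ)) ^ 2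
      + 8000 * (PowerSeries.mk fun n => (ArithmeticFunction.sigma 3 n : ℤ)) ^ 3
      - 147 * (PowerSeries.mk fun n => (ArithmeticFunction.sigma 5 n : ℤ)) ^ 2)
    rw [map_sub, map_add, map_add, map_mul, map_mul, map_mul, map_pow, map_pow, map_pow,
      map_ofNat, map_ofNat, map_ofNat] at this
    exact this
  have hA : laurentMod 5 eis4 = 1 + 240 * laurentMod 5 (divisorSeries 3) := by
    rw [eis4]; simp only [map_add, map_mul, map_one, map_ofNat]
  have hA1 : laurentMod 5 eis4 = 1 := by
    rw [hA]; linear_combination 48 * laurentMod 5 (divisorSeries 3) * h5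
  obtain ⟨hx, hVB, hVJ⟩ := level_five_algebra h5 (laurentMod_jSeries_mul 5)
    (VD := laurentV _ 5 (laurentMod 5 discSeries)) (VJ := laurentV _ 5 (laurentMod 5 jSeries))
    (by rw [← map_mul, laurentMod_jSeries_mul, hA1, one_pow, map_one]) hA
    (by simpa only [map_sub, map_mul, map_ofNat, map_pow]
          using congrArg (laurentMod 5) discSeries_eq) hfrobD hfrob6
  have hW : laurentV _ 5 (laurentMod 5 (eisMonomial a b)) =
      laurentMod 5 (eisMonomial a b) * ((1 - 3 * laurentMod 5 discSeries) ^ 2) ^ b := by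
    simp only [eisMonomial, map_mul, map_pow, hVB, hA1, map_one, mul_pow]; ring
  have hX : (X ^ 5 : (ZMod 5)[X]).eval₂ HahnSeries.C (laurentMod 5 jSeries) =
      laurentMod 5 jSeries ^ 5 := by simp
  generalize laurentMod 5 discSeries = x at *
  have hc : b = 0 ∨ (b = 1 ∧ ∃ c, weightModulus k = 5 * c) := by
    rcases hk with ⟨rfl, rfl, rfl⟩ | ⟨rfl, rfl, rfl⟩ | ⟨rfl, rfl, rfl⟩ |
      ⟨rfl, rfl, rfl⟩ |
      ⟨rfl, rfl, rfl⟩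
    · simp
    · exact .inr ⟨rfl, 48, by simp [weightModulus]⟩
    · simp
    · exact .inr ⟨rfl, 96, by simp [weightModulus]⟩
    · exact .inr ⟨rfl, 144, by simp [weightModulus]⟩
  rcases hc with rfl | ⟨rfl, c, hc⟩
  · exact ⟨_, X ^ 5, X ^ 5, hW, by rw [hX, hVJ], by rw [hX, hVJ]; ring, by simp⟩
  · refine ⟨_, X ^ 5, X ^ 5 - 6 * X ^ 4 + 9 * X ^ 3, hW, by rw [hX, hVJ], ?_, ?_⟩
    · rw [hVJ]
      simp only [eval₂_sub, eval₂_add, eval₂_mul, eval₂_ofNat, eval₂_X_pow]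
      generalize laurentMod 5 jSeries = J at *
      linear_combination (-6 * J ^ 4 + 9 * J ^ 3 * (J * x + 1)) * hx
    · rw [hc, Int.cast_mul, Int.cast_ofNat, h5]; ring

end Reductions

section Expansions

/-- `f` is the sum of the Laurent series `s` in `q = e^{2 π i τ}`. -/
def IsSumOf (f : ℍ → ℂ) (s : LaurentSeries ℂ) : Prop :=
  ∀ τ : ℍ, HasSum (fun n : ℤ => s.coeff n * qexp τ ^ n) (f τ)

lemma qexp_ne_zero (τ : ℍ) : qexp τ ≠ 0 := Complex.exp_ne_zero _

lemma qexp_eq_qParam (τ : ℍ) : qexp τ = Function.Periodic.qParam 1 τ := by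
  simp [qexp, Function.Periodic.qParam]

/-- The reindexing `(n, i) ↦ (i, n - i)` of the Cauchy product. -/
def shearEquiv : ℤ × ℤ ≃ ℤ × ℤ where
  toFun x := (x.2, x.1 - x.2)
  invFun y := (y.1 + y.2, y.1)
  left_inv x := by simp
  right_inv y := by simp

lemma hasSum_int_cauchy {u v : ℤ → ℂ} {x y : ℂ} (hu : HasSum u x) (hv : HasSum v y) :
    HasSum (fun i : ℤ × ℤ => u i.2 * v (i.1 - i.2)) (x * y) :=
  shearEquiv.hasSum_iff.mpr (hu.mul hv (summable_mul_of_summable_norm hu.summable.norm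
    hv.summable.norm))

namespace IsSumOf

variable {f g : ℍ → ℂ} {s t : LaurentSeries ℂ}

lemma add (hf : IsSumOf f s) (hg : IsSumOf g t) : IsSumOf (f + g) (s + t) := fun τ => by
  simpa [add_mul] using (hf τ).add (hg τ)

lemma sub (hf : IsSumOf f s) (hg : IsSumOf g t) : IsSumOf (f - g) (s - t) := fun τ => by
  simpa [sub_mul] using (hf τ).sub (hg τ)

lemma const_smul (hf : IsSumOf f s) (c : ℂ) : IsSumOf (c • f) (HahnSeries.C c * s) := fun τ => by
  simpa [laurent_C_mul_coeff, mul_assoc] using (hf τ).mul_left c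

lemma one : IsSumOf 1 1 := fun τ => by
  have h := hasSum_ite_eq (0 : ℤ) (1 : ℂ)
  simp only [Pi.one_apply]
  convert h using 2 with n
  rw [HahnSeries.coeff_one]
  split_ifs with hn <;> simp [hn]

lemma mul (hf : IsSumOf f s) (hg : IsSumOf g t) : IsSumOf (f * g) (s * t) := fun τ => by
  obtain ⟨a, ha⟩ := laurent_exists_bound s
  obtain ⟨b, hb⟩ := laurent_exists_bound t
  have h' : HasSum (fun x : ℤ × ℤ => s.coeff x.2 * t.coeff (x.1 - x.2) * qexp τ ^ x.1)
      (f τ * g τ) := by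
    convert hasSum_int_cauchy (hf τ) (hg τ) using 2 with x
    rw [show qexp τ ^ x.1 = qexp τ ^ x.2 * qexp τ ^ (x.1 - x.2) by
      rw [← zpow_add₀ (qexp_ne_zero τ)]; congr 1; ring]
    ring
  refine h'.prod_fiberwise fun n => ?_
  rw [laurent_coeff_mul ha hb, Finset.sum_mul]
  have hz (i : ℤ) (hi : i ∉ Finset.Icc a (n - b)) :
      s.coeff i * t.coeff (n - i) * qexp τ ^ n = 0 := by
    rw [Finset.mem_Icc, not_and_or, not_le, not_le] at hi
    rcases hi with hi | hi
    · rw [ha i hi]; ring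
    · rw [hb _ (by omega : n - i < b)]; ring
  exact hasSum_sum_of_ne_finset_zero hz

lemma hasSum_nat (hf : IsSumOf f s) (hs : ∀ n < 0, s.coeff n = 0) (τ : ℍ) :
    HasSum (fun n : ℕ => s.coeff n • Function.Periodic.qParam 1 τ ^ n) (f τ) := by
  have h := hf τ
  rw [← Function.Injective.hasSum_iff Nat.cast_injective] at h
  · simpa [Function.comp_def, qexp_eq_qParam] using h
  · intro n hn
    rw [hs n (by by_contra h0; exact hn ⟨n.toNat, by simp; omega⟩), zero_mul]

lemma eq_zero (hs : IsSumOf 0 s) : s = 0 := by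
  obtain ⟨a, ha⟩ := laurent_exists_bound s
  have h1 (τ : ℍ) : HasSum (fun n : ℕ => s.coeff (n + a) • Function.Periodic.qParam 1 τ ^ n)
      ((0 : ℍ → ℂ) τ) := by
    have h : IsSumOf 0 (HahnSeries.single (-a) 1 * s) := by
      intro τ
      have h2 := (hs τ).mul_left (qexp τ ^ (-a))
      rw [← (Equiv.addRight a).hasSum_iff] at h2
      have hterm (n : ℤ) : (HahnSeries.single (-a) 1 * s).coeff n * qexp τ ^ n =
          qexp τ ^ (-a) * (s.coeff (n + a) * qexp τ ^ (n + a)) := by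
        have := HahnSeries.coeff_single_mul_add (r := (1 : ℂ)) (x := s) (a := n + a) (b := -a)
        rw [show n + a + -a = n by ring, one_mul] at this
        rw [this, mul_left_comm, ← zpow_add₀ (qexp_ne_zero τ)]
        congr 2; ring
      simpa [Function.comp_def, hterm] using h2
    have hc (n : ℤ) : (HahnSeries.single (-a) 1 * s).coeff n = s.coeff (n + a) := by
      have := HahnSeries.coeff_single_mul_add (r := (1 : ℂ)) (x := s) (a := n + a) (b := -a)
      rwa [show n + a + -a = n by ring, one_mul] at this
    have := h.hasSum_nat (fun n hn => by rw [hc]; exact ha _ (by omega)) τ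
    simpa only [hc] using this
  have h2 (n : ℕ) := ModularFormClass.qExpansion_coeff_unique one_pos one_mem_strictPeriods_SL
    (f := (0 : ModularForm 𝒮ℒ 0)) h1 n
  ext n
  by_cases hn : n < a
  · exact ha n hn
  · have := h2 (n - a).toNat
    rw [show ⇑(0 : ModularForm 𝒮ℒ 0) = 0 from rfl, qExpansion_zero] at this
    simpa [show ((n - a).toNat : ℤ) = n - a by omega] using this

end IsSumOf

end Expansions

section LevelOne

/-- `f` is a holomorphic function on `ℍ`, invariant of weight `k` under `SL(2, ℤ)`, and with
Laurent expansion `s` in `q`. -/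
structure IsLevelOne (k : ℤ) (f : ℍ → ℂ) (s : LaurentSeries ℂ) : Prop where
  holo : MDifferentiable 𝓘(ℂ) 𝓘(ℂ) f
  slash_eq : ∀ γ : SL(2, ℤ), f ∣[k] γ = f
  isSumOf : IsSumOf f s

namespace IsLevelOne

variable {k l : ℤ} {f g : ℍ → ℂ} {s t : LaurentSeries ℂ}

lemma add (hf : IsLevelOne k f s) (hg : IsLevelOne k g t) : IsLevelOne k (f + g) (s + t) :=
  ⟨hf.holo.add hg.holo, fun γ => by rw [SlashAction.add_slash, hf.slash_eq, hg.slash_eq],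
    hf.isSumOf.add hg.isSumOf⟩

lemma sub (hf : IsLevelOne k f s) (hg : IsLevelOne k g t) : IsLevelOne k (f - g) (s - t) :=
  ⟨hf.holo.sub hg.holo, fun γ => by
    rw [sub_eq_add_neg, SlashAction.add_slash, SlashAction.neg_slash, hf.slash_eq, hg.slash_eq],
    hf.isSumOf.sub hg.isSumOf⟩

lemma const_smul (hf : IsLevelOne k f s) (c : ℂ) : IsLevelOne k (c • f) (HahnSeries.C c * s) :=
  ⟨hf.holo.const_smul c, fun γ => by rw [ModularForm.SL_smul_slash, hf.slash_eq],
    hf.isSumOf.const_smul c⟩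

lemma mul (hf : IsLevelOne k f s) (hg : IsLevelOne l g t) : IsLevelOne (k + l) (f * g) (s * t) :=
  ⟨hf.holo.mul hg.holo, fun γ => by rw [ModularForm.mul_slash_SL2, hf.slash_eq, hg.slash_eq],
    hf.isSumOf.mul hg.isSumOf⟩

lemma one : IsLevelOne 0 1 1 :=
  ⟨mdifferentiable_const, fun γ => ModularForm.is_invariant_one γ, IsSumOf.one⟩

lemma pow (hf : IsLevelOne k f s) (n : ℕ) : IsLevelOne (n * k) (f ^ n) (s ^ n) := by
  induction n with
  | zero => simpa using one
  | succ n ih => simpa [pow_succ, add_mul] using ih.mul hf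

lemma sum {ι : Type*} {I : Finset ι} {F : ι → ℍ → ℂ} {S : ι → LaurentSeries ℂ}
    (h : ∀ i ∈ I, IsLevelOne k (F i) (S i)) : IsLevelOne k (∑ i ∈ I, F i) (∑ i ∈ I, S i) := by
  classical
  induction I using Finset.induction_on with
  | empty =>
    simp only [Finset.sum_empty]
    exact ⟨mdifferentiable_const, fun γ => SlashAction.zero_slash k γ, fun τ => by simp⟩
  | insert i I hi ih =>
    rw [Finset.sum_insert hi, Finset.sum_insert hi]
    exact (h i (Finset.mem_insert_self i I)).add
      (ih fun j hj => h j (Finset.mem_insert_of_mem hj))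

lemma of_modularForm (F : ModularForm 𝒮ℒ k) (h : ∀ n : ℕ, s.coeff n = (qExpansion 1 F).coeff n)
    (hs : ∀ n < 0, s.coeff n = 0) : IsLevelOne k F s where
  holo := F.holo'
  slash_eq γ := SlashInvariantForm.slash_action_eqn F _ ⟨γ, rfl⟩
  isSumOf τ := by
    have := ModularForm.hasSum_qExpansion (f := F) one_pos one_mem_strictPeriods_SL τ
    rw [← Function.Injective.hasSum_iff Nat.cast_injective]
    · simpa [Function.comp_def, qexp_eq_qParam, h] using this
    · intro n hn
      rw [hs n (by by_contra h0; exact hn ⟨n.toNat, by simp; omega⟩), zero_mul]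

/-- The modular form attached to a level one function with holomorphic expansion at `∞`. -/
lemma exists_modularForm (hf : IsLevelOne k f s) (hs : ∀ n < 0, s.coeff n = 0) :
    ∃ F : ModularForm 𝒮ℒ k, ⇑F = f ∧ ∀ n : ℕ, (qExpansion 1 F).coeff n = s.coeff n := by
  have hsum := hf.isSumOf.hasSum_nat hs
  have hb : IsBoundedAtImInfty f := isBoundedAtImInfty_of_hasSum_qExpansion one_pos hsum
  let F : ModularForm 𝒮ℒ k := ⟨⟨f, by rintro _ ⟨γ, rfl⟩; exact hf.slash_eq γ⟩, hf.holo, by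
    intro c hc
    rw [OnePoint.isBoundedAt_iff_forall_SL2Z hc]
    intro γ _
    exact (hf.slash_eq γ).symm ▸ hb⟩
  exact ⟨F, rfl, fun n => (ModularFormClass.qExpansion_coeff_unique one_pos
    one_mem_strictPeriods_SL (f := F) hsum n).symm⟩

end IsLevelOne

lemma ModularForm.eq_zero_of_le_order {k : ℤ} (h0 : ∀ g : ModularForm 𝒮ℒ k, g = 0) (m : ℕ) :
    ∀ {w : ℤ} (f : ModularForm 𝒮ℒ w), w = k + 12 * m → (m : ℕ∞) ≤ (qExpansion 1 f).order →
      f = 0 := by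
  induction m with
  | zero =>
    rintro w f hw -
    obtain rfl : w = k := by simpa using hw
    exact h0 f
  | succ m ih =>
    intro w f hw hm
    have hc : (qExpansion 1 f).coeff 0 = 0 := PowerSeries.coeff_of_lt_order _
      (lt_of_lt_of_le (by simp) hm)
    suffices CuspForm.discriminantEquiv (toCuspForm f hc) = 0 by
      simpa [CuspForm.discriminantEquiv.map_eq_zero_iff, DFunLike.ext_iff]
    refine ih _ (by rw [hw]; push_cast; ring) ?_
    rw [qExpansion_eq_qExpansion_discriminant_mul f hc, PowerSeries.order_mul,
      discriminant_qExpansion_order, Nat.cast_add, Nat.cast_one,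
      add_comm (1 : ℕ∞)] at hm
    exact (ENat.add_le_add_iff_right ENat.one_ne_top).mp hm

lemma IsLevelOne.eq_zero {k w : ℤ} {f : ℍ → ℂ} {s : LaurentSeries ℂ} (hf : IsLevelOne w f s)
    (hk : k < 0 ∨ k = 2) (m : ℕ) (hw : w = k + 12 * m) (hs : ∀ n < (m : ℤ), s.coeff n = 0) :
    f = 0 ∧ s = 0 := by
  obtain ⟨F, rfl, hF⟩ := hf.exists_modularForm fun n hn => hs n (by omega)
  have h0 : ∀ g : ModularForm 𝒮ℒ k, g = 0 := by
    rcases hk with hk | rfl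
    · exact rank_zero_iff_forall_zero.mp (ModularForm.levelOne_neg_weight_rank_zero hk)
    · exact rank_zero_iff_forall_zero.mp ModularForm.levelOne_weight_two_rank_zero
  obtain rfl : F = 0 := ModularForm.eq_zero_of_le_order h0 m F hw
    (PowerSeries.nat_le_order _ _ fun i hi => by rw [hF]; exact hs i (by exact_mod_cast hi))
  exact ⟨rfl, hf.isSumOf.eq_zero⟩

end LevelOne

section LevelOneForms

/-- Complexification of integral Laurent series. -/
abbrev laurentComplex : LaurentSeries ℤ →+* LaurentSeries ℂ := laurentMap (Int.castRingHom ℂ)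

lemma laurentComplex_injective : Function.Injective laurentComplex := fun x y h => by
  ext n
  simpa using congrArg (fun s => s.coeff n) h

lemma divisorSeries_coeff (k : ℕ) (n : ℕ) :
    (divisorSeries k).coeff n = ArithmeticFunction.sigma k n := by
  rw [divisorSeries, ofPowerSeries_coeff_natCast, PowerSeries.coeff_mk]

lemma isLevelOne_eis4 : IsLevelOne 4 ModularForm.E₄ (laurentComplex eis4) := by
  refine .of_modularForm ModularForm.E₄ (fun n => ?_) fun n hn => ?_
  · rw [EisensteinSeries.E_qExpansion_coeff _ ⟨2, rfl⟩,
      show bernoulli 4 = -1 / 30 by decide +kernel,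
      eis4, laurentMap_coeff, HahnSeries.coeff_add, laurent_ofNat_mul_coeff, divisorSeries_coeff,
      HahnSeries.coeff_one]
    rcases eq_or_ne n 0 with rfl | h
    · simp
    · simp [h]; ring
  · simp [isMonicAt_eis4.1 n hn]

lemma isLevelOne_eis6 : IsLevelOne 6 ModularForm.E₆ (laurentComplex eis6) := by
  refine .of_modularForm ModularForm.E₆ (fun n => ?_) fun n hn => ?_
  · rw [EisensteinSeries.E_qExpansion_coeff _ ⟨3, rfl⟩, show bernoulli 6 = 1 / 42 by decide +kernel,
      eis6, laurentMap_coeff, HahnSeries.coeff_sub, laurent_ofNat_mul_coeff, divisorSeries_coeff,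
      HahnSeries.coeff_one]
    rcases eq_or_ne n 0 with rfl | h
    · simp
    · simp [h]; norm_num
  · simp [isMonicAt_eis6.1 n hn]

lemma isLevelOne_disc : IsLevelOne 12 ModularForm.discriminant (laurentComplex discSeries) := by
  have h := ((isLevelOne_eis4.pow 3).sub (isLevelOne_eis6.pow 2)).const_smul (1 / 1728)
  convert h using 1
  · norm_num
  · ext z
    simp only [ModularForm.discriminant_eq_E₄_cube_sub_E₆_sq, Pi.smul_apply, Pi.sub_apply,
      Pi.pow_apply, smul_eq_mul]
    ring
  · rw [← map_pow, ← map_pow, ← map_sub, ← discSeries_eq]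
    ext n
    rw [laurent_C_mul_coeff, laurentMap_coeff, laurentMap_coeff, laurent_ofNat_mul_coeff]
    simp

lemma norm_qexp_zpow (τ : ℍ) (n : ℤ) : ‖qexp τ ^ n‖ = Real.exp (-(2 * π * n * τ.im)) := by
  rw [norm_zpow, qexp, Complex.norm_exp, ← Real.rpow_intCast, ← Real.exp_mul]
  congr 1
  simp
  ring

lemma IsSumOf.normalizedDeriv {f : ℍ → ℂ} {s : LaurentSeries ℂ} (hf : IsSumOf f s) :
    IsSumOf (Derivative.normalizedDerivOfComplex f) (eulerOp s) := by
  intro τ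
  let τ₁ : ℍ := ⟨τ.im / 2 * Complex.I, by simpa using half_pos τ.im_pos⟩
  let τ₂ : ℍ := ⟨2 * τ.im * Complex.I, by simpa using τ.im_pos⟩
  have h1 : τ₁.im = τ.im / 2 := by simp [τ₁, ← UpperHalfPlane.coe_im]
  have h2 : τ₂.im = 2 * τ.im := by simp [τ₂, ← UpperHalfPlane.coe_im]
  let U : Set ℂ := {w | τ₁.im < w.im} ∩ {w | w.im < τ₂.im}
  have hU : IsOpen U := (isOpen_lt continuous_const Complex.continuous_im).inter
    (isOpen_lt Complex.continuous_im continuous_const)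
  have hτU : (τ : ℂ) ∈ U := by
    have := τ.im_pos
    simp only [U, Set.mem_inter_iff, Set.mem_ofPred_eq, h1, h2, UpperHalfPlane.coe_im]
    constructor <;> linarith
  let F : ℤ → ℂ → ℂ := fun n w => s.coeff n * Complex.exp (2 * π * Complex.I * n * w)
  have hF (n : ℤ) (w : ℂ) : HasDerivAt (F n) (2 * π * Complex.I * (n * F n w)) w := by
    have := ((hasDerivAt_id w).const_mul (2 * π * Complex.I * n)).cexp.const_mul (s.coeff n)
    simp only [id] at this
    refine this.congr_deriv ?_
    simp only [F]
    ring
  have hFτ (n : ℤ) (w : ℍ) : F n w = s.coeff n * qexp w ^ n := by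
    simp only [F, qexp, ← Complex.exp_int_mul]
    congr 2; ring
  have hsum := hasSum_deriv_of_summable_norm (F := F) (U := U) (z := (τ : ℂ))
    ((hf τ₁).summable.norm.add (hf τ₂).summable.norm)
    (fun n w _ => (hF n w).differentiableAt.differentiableWithinAt) hU (fun n w hw => ?_) hτU
  · have heq : deriv (fun w => ∑' n, F n w) τ = deriv (f ∘ ofComplex) τ := by
      refine Filter.EventuallyEq.deriv_eq ?_
      filter_upwards [isOpen_upperHalfPlaneSet.mem_nhds τ.im_pos] with w hw
      rw [Function.comp_apply, ofComplex_apply_of_im_pos hw]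
      simpa [← hFτ] using (hf ⟨w, hw⟩).tsum_eq
    rw [heq] at hsum
    have := hsum.mul_left (2 * π * Complex.I)⁻¹
    have hterm (n : ℤ) : (2 * π * Complex.I)⁻¹ * deriv (F n) τ =
        (eulerOp s).coeff n * qexp τ ^ n := by
      rw [(hF n τ).deriv, hFτ, eulerOp_coeff, inv_mul_cancel_left₀ Complex.two_pi_I_ne_zero]
      ring
    simp only [hterm] at this
    exact this
  · have hb : ‖F n w‖ = ‖s.coeff n‖ * Real.exp (-(2 * π * n * w.im)) := by
      have hw0 : 0 < w.im := lt_trans τ₁.im_pos hw.1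
      rw [show w = ((⟨w, hw0⟩ : ℍ) : ℂ) from rfl, hFτ, norm_mul, norm_qexp_zpow]
      rfl
    rw [hb, norm_mul, norm_mul, norm_qexp_zpow, norm_qexp_zpow, ← mul_add]
    refine mul_le_mul_of_nonneg_left ?_ (norm_nonneg _)
    have hpi := Real.pi_pos
    have hw1 : τ₁.im ≤ w.im := hw.1.le
    have hw2 : w.im ≤ τ₂.im := hw.2.le
    rcases le_total 0 n with hn | hn
    · have hn' : (0 : ℝ) ≤ 2 * π * n := by positivity
      refine le_add_of_le_of_nonneg (Real.exp_le_exp.mpr ?_) (Real.exp_nonneg _)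
      nlinarith
    · have hn' : 2 * π * n ≤ 0 :=
        mul_nonpos_of_nonneg_of_nonpos (by positivity) (by exact_mod_cast hn)
      refine le_add_of_nonneg_of_le (Real.exp_nonneg _) (Real.exp_le_exp.mpr ?_)
      nlinarith

end LevelOneForms

section BasisElements

lemma laurentMap_eulerOp {R S : Type*} [CommRing R] [CommRing S] (f : R →+* S)
    (x : LaurentSeries R) : laurentMap f (eulerOp x) = eulerOp (laurentMap f x) := by
  ext n
  simp

/-- The first Rankin–Cohen bracket of two forms of level one. -/
lemma IsLevelOne.bracket {k l : ℤ} {f g : ℍ → ℂ} {s t : LaurentSeries ℂ} (hf : IsLevelOne k f s)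
    (hg : IsLevelOne l g t) :
    IsLevelOne (k + (l + 2))
      ((k : ℂ) • (f * Derivative.normalizedDerivOfComplex g) -
        (l : ℂ) • (g * Derivative.normalizedDerivOfComplex f))
      (HahnSeries.C (k : ℂ) * (s * eulerOp t) - HahnSeries.C (l : ℂ) * (t * eulerOp s)) := by
  have heq : (k : ℂ) • (f * Derivative.normalizedDerivOfComplex g) -
        (l : ℂ) • (g * Derivative.normalizedDerivOfComplex f) =
      (k : ℂ) • (f * Derivative.serreDerivative l g) -
        (l : ℂ) • (g * Derivative.serreDerivative k f) := by
    ext z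
    simp only [Pi.sub_apply, Pi.smul_apply, Pi.mul_apply, smul_eq_mul,
      Derivative.serreDerivative_apply]
    ring
  refine ⟨?_, fun γ => ?_, ?_⟩
  · rw [heq]
    exact ((hf.holo.mul (Derivative.serreDerivative_mdifferentiable _ hg.holo)).const_smul _).sub
      ((hg.holo.mul (Derivative.serreDerivative_mdifferentiable _ hf.holo)).const_smul _)
  · rw [heq, sub_eq_add_neg, SlashAction.add_slash, SlashAction.neg_slash,
      ModularForm.SL_smul_slash, ModularForm.SL_smul_slash, ModularForm.mul_slash_SL2, hf.slash_eq,
      Derivative.serreDerivative_slash_invariant hg.holo (hg.slash_eq γ),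
      show k + (l + 2) = l + (k + 2) by ring, ModularForm.mul_slash_SL2, hg.slash_eq,
      Derivative.serreDerivative_slash_invariant hf.holo (hf.slash_eq γ)]
  · exact ((hf.isSumOf.mul hg.isSumOf.normalizedDeriv).const_smul _).sub
      ((hg.isSumOf.mul hf.isSumOf.normalizedDeriv).const_smul _)

/-- `q dj/dq = -j E₆ / E₄`, with denominators cleared. -/
lemma eulerOp_eis4_discSeries :
    3 * eulerOp eis4 * discSeries - eis4 * eulerOp discSeries = -(eis6 * discSeries) := by
  have h := (isLevelOne_disc.bracket isLevelOne_eis4).add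
    ((isLevelOne_eis6.mul isLevelOne_disc).const_smul 4)
  set x : LaurentSeries ℤ :=
    3 * eulerOp eis4 * discSeries - eis4 * eulerOp discSeries + eis6 * discSeries with hx
  have hs : HahnSeries.C ((12 : ℤ) : ℂ) *
      (laurentComplex discSeries * eulerOp (laurentComplex eis4)) -
      HahnSeries.C ((4 : ℤ) : ℂ) * (laurentComplex eis4 * eulerOp (laurentComplex discSeries)) +
      HahnSeries.C 4 * (laurentComplex eis6 * laurentComplex discSeries) =
      laurentComplex (4 * x) := by
    have h12 : HahnSeries.C ((12 : ℤ) : ℂ) = (12 : LaurentSeries ℂ) := by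
      rw [Int.cast_ofNat, map_ofNat]
    have h4 : HahnSeries.C (4 : ℂ) = (4 : LaurentSeries ℂ) := map_ofNat _ 4
    rw [h12, Int.cast_ofNat, h4, hx]
    simp only [map_mul, map_add, map_sub, map_ofNat, laurentMap_eulerOp]
    ring
  rw [hs] at h
  have hz : ∀ n < (2 : ℤ), x.coeff n = 0 := by
    have hE : ∀ n < (1 : ℤ), (eulerOp eis4).coeff n = 0 := fun n hn => by
      rcases (show n < 0 ∨ n = 0 by omega) with h | rfl
      · simp [isMonicAt_eis4.1 n h]
      · simp
    have hD : IsMonicAt (eulerOp discSeries) 1 :=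
      ⟨fun n hn => by simp [isMonicAt_discSeries.1 n hn], by simp [isMonicAt_discSeries.2]⟩
    have h1 := isMonicAt_eis4.mul hD
    have h2 := isMonicAt_eis6.mul isMonicAt_discSeries
    intro n hn
    rw [hx, mul_assoc, HahnSeries.coeff_add, HahnSeries.coeff_sub, laurent_ofNat_mul_coeff,
      laurent_mul_coeff_eq_zero hE isMonicAt_discSeries.1 (by omega)]
    rcases (show n < 0 + 1 ∨ n = 0 + 1 by omega) with h | rfl
    · rw [h1.1 n h, h2.1 n h]; ring
    · rw [h1.2, h2.2]; ring
  have h0 := (h.eq_zero (k := -6) (by norm_num) 2 (by norm_num) fun n hn => by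
    rw [laurentMap_coeff, laurent_ofNat_mul_coeff, hz n (by exact_mod_cast hn)]; simp).2
  have h4 : 4 * x = 0 := laurentComplex_injective (by rw [h0, map_zero])
  have hx0 : x = 0 := by
    ext n
    have h5 : (4 * x).coeff n = 0 := by rw [h4, HahnSeries.coeff_zero]
    rw [laurent_ofNat_mul_coeff] at h5
    simpa using h5
  rw [hx] at hx0
  linear_combination hx0

/-- The Laurent series of a weakly holomorphic form. -/
def WhmForm.series {Γ : Subgroup SL(2, ℤ)} {k : ℤ} (f : WhmForm Γ k) : LaurentSeries ℂ where
  coeff := f.coeff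
  isPWO_support' := by
    obtain ⟨N, hN⟩ := f.expansion.1
    exact (HahnSeries.ofSuppBddBelow f.coeff
      ⟨N, fun n hn => not_lt.mp fun h => hn (hN n h)⟩).isPWO_support

@[simp] lemma WhmForm.series_coeff {Γ : Subgroup SL(2, ℤ)} {k : ℤ} (f : WhmForm Γ k) (n : ℤ) :
    f.series.coeff n = f.coeff n := rfl

lemma WhmForm.isLevelOne {k : ℤ} (f : WhmForm ⊤ k) : IsLevelOne k f.toFun f.series :=
  ⟨f.holo, fun γ => f.slash_eq γ trivial, f.expansion.2⟩

lemma IsBasisElt.exists_eisMonomial_mul_eval₂ {k a b m : ℕ} (hk : IsWeightPair k a b)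
    {f : WhmForm ⊤ (k : ℤ)} (hf : IsBasisElt (k : ℤ) 0 (m : ℤ) f) :
    ∃ P : Polynomial ℤ,
      laurentComplex (eisMonomial a b * P.eval₂ HahnSeries.C jSeries) = f.series := by
  obtain ⟨P, hP, hcoeff⟩ := exists_polynomial_eval₂ (isMonicAt_eisMonomial a b) isMonicAt_jSeries m
    (HahnSeries.single (-(m : ℤ)) (1 : ℤ)) fun n hn => HahnSeries.coeff_single_of_ne hn.ne
  refine ⟨P, ?_⟩
  set R := f.series - laurentComplex (eisMonomial a b * P.eval₂ HahnSeries.C jSeries) with hR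
  have hR0 : ∀ n < (1 : ℤ), R.coeff n = 0 := by
    intro n hn
    have h1 := congrArg (Int.cast : ℤ → ℂ) (hcoeff n (by omega))
    rw [HahnSeries.coeff_sub, Int.cast_sub, sub_eq_iff_eq_add, Int.cast_zero, zero_add] at h1
    rw [hR, HahnSeries.coeff_sub, laurentMap_coeff, eq_intCast, ← h1, WhmForm.series_coeff]
    rcases eq_or_ne n (-m) with rfl | h
    · rw [hf.1]; simp
    · rw [hf.2 n h (by omega), HahnSeries.coeff_single_of_ne h]; simp
  have hterm (i : ℕ) (hi : i ∈ Finset.range (m + 1)) :=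
    (((isLevelOne_eis4.pow (a + 3 * i)).mul (isLevelOne_eis6.pow b)).mul
      (isLevelOne_disc.pow (m - i))).const_smul (P.coeff i : ℂ)
  have hwt (i : ℕ) (hi : i ∈ Finset.range (m + 1)) :
      ((a + 3 * i : ℕ) : ℤ) * 4 + (b : ℤ) * 6 + ((m - i : ℕ) : ℤ) * 12 = (m : ℤ) * 12 + k := by
    rw [Finset.mem_range] at hi
    rcases hk with ⟨rfl, rfl, rfl⟩ | ⟨rfl, rfl, rfl⟩ | ⟨rfl, rfl, rfl⟩ |
      ⟨rfl, rfl, rfl⟩ |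
      ⟨rfl, rfl, rfl⟩ <;> push_cast [show i ≤ m by omega] <;> ring
  have hdiff := ((isLevelOne_disc.pow m).mul f.isLevelOne).sub
    (IsLevelOne.sum fun i hi => hwt i hi ▸ hterm i hi)
  have hser : laurentComplex discSeries ^ m * f.series -
      ∑ i ∈ Finset.range (m + 1), HahnSeries.C (P.coeff i : ℂ) *
        (laurentComplex eis4 ^ (a + 3 * i) * laurentComplex eis6 ^ b *
          laurentComplex discSeries ^ (m - i)) = laurentComplex discSeries ^ m * R := by
    rw [hR, mul_sub, Polynomial.eval₂_eq_sum_range' _ (Nat.lt_succ_of_le hP), Finset.mul_sum,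
      map_sum, Finset.mul_sum]
    congr 1
    refine Finset.sum_congr rfl fun i hi => ?_
    have hi' : i ≤ m := by rw [Finset.mem_range] at hi; omega
    have hC : laurentComplex (HahnSeries.C (P.coeff i)) = HahnSeries.C (P.coeff i : ℂ) := by
      rw [eq_intCast, map_intCast, map_intCast]
    rw [← hC, ← map_pow, ← map_pow, ← map_pow, ← map_pow, ← map_mul, ← map_mul, ← map_mul,
      ← map_mul]
    congr 1
    rw [eisMonomial, show discSeries ^ m = discSeries ^ (m - i) * discSeries ^ i by
      rw [← pow_add]; congr 1; omega, pow_add, pow_mul, ← jSeries_mul_discSeries, mul_pow]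
    ring
  rw [hser] at hdiff
  have hk2 : (k : ℤ) - 12 < 0 ∨ (k : ℤ) - 12 = 2 := by
    rcases hk with ⟨rfl, -⟩ | ⟨rfl, -⟩ | ⟨rfl, -⟩ | ⟨rfl, -⟩ | ⟨rfl, -⟩ <;> norm_num
  have h0 := (hdiff.eq_zero hk2 (m + 1) (by push_cast; ring) fun n hn =>
    laurent_mul_coeff_eq_zero ((isMonicAt_discSeries.map _).pow m).1 hR0
      (by push_cast at hn; omega)).2
  have hD : laurentComplex discSeries ≠ 0 := fun h => by
    simpa [h] using (isMonicAt_discSeries.map (Int.castRingHom ℂ)).2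
  exact (sub_eq_zero.mp ((mul_eq_zero.mp h0).resolve_left (pow_ne_zero m hD))).symm

end BasisElements

section Hecke

open ModularGroup Matrix

/-- The matrix `(p 0; 0 1)`. -/
def scaleMatrix (p : ℕ) [NeZero p] : GL (Fin 2) ℝ :=
  GeneralLinearGroup.mkOfDetNeZero !![(p : ℝ), 0; 0, 1] (by simp [NeZero.ne p])

/-- The matrix `(1 j; 0 p)`. -/
def shiftMatrix (p : ℕ) [NeZero p] (j : ℤ) : GL (Fin 2) ℝ :=
  GeneralLinearGroup.mkOfDetNeZero !![1, (j : ℝ); 0, (p : ℝ)] (by simp [NeZero.ne p])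

variable {k : ℤ} {f : ℍ → ℂ} {p : ℕ} [NeZero p]

lemma slash_eq_of_eq_mul (hf : ∀ γ : SL(2, ℤ), f ∣[k] γ = f) {α β : GL (Fin 2) ℝ}
    (γ : SL(2, ℤ)) (h : α.1 = γ.1.map Int.cast * β.1) : f ∣[k] α = f ∣[k] β := by
  have h' : α = (γ : GL (Fin 2) ℝ) * β := Units.ext h
  rw [h', SlashAction.slash_mul, ← ModularForm.SL_slash, hf]

lemma slash_slash_of_mul_eq (hf : ∀ γ : SL(2, ℤ), f ∣[k] γ = f) {α β : GL (Fin 2) ℝ}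
    (γ : SL(2, ℤ)) {δ : SL(2, ℤ)} (h : α.1 * δ.1.map Int.cast = γ.1.map Int.cast * β.1) :
    (f ∣[k] α) ∣[k] δ = f ∣[k] β := by
  rw [ModularForm.SL_slash, ← SlashAction.slash_mul]
  exact slash_eq_of_eq_mul hf γ h

lemma slash_shiftMatrix_congr (hf : ∀ γ : SL(2, ℤ), f ∣[k] γ = f) {i j : ℤ}
    (h : (i : ZMod p) = j) : f ∣[k] shiftMatrix p i = f ∣[k] shiftMatrix p j := by
  obtain ⟨n, hn⟩ := (ZMod.intCast_eq_intCast_iff_dvd_sub _ _ _).mp h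
  refine slash_eq_of_eq_mul hf ⟨!![1, -n; 0, 1], by simp⟩ ?_
  have : (j : ℝ) = i + p * n := by rw [eq_add_of_sub_eq' hn]; push_cast; ring
  ext a b
  fin_cases a <;> fin_cases b <;>
    simp [shiftMatrix, Matrix.mul_apply, Fin.sum_univ_two, this]
  ring

/-- The Hecke operator `T_p`. -/
def heckeOp (p : ℕ) [NeZero p] (k : ℤ) (f : ℍ → ℂ) : ℍ → ℂ :=
  f ∣[k] scaleMatrix p + ∑ j : ZMod p, f ∣[k] shiftMatrix p j.cast

lemma slash_shiftMatrix_cast (hf : ∀ γ : SL(2, ℤ), f ∣[k] γ = f) (j : ℤ) :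
    f ∣[k] shiftMatrix p (j : ZMod p).cast = f ∣[k] shiftMatrix p j :=
  slash_shiftMatrix_congr hf (by simp)

lemma heckeOp_slash_T (hf : ∀ γ : SL(2, ℤ), f ∣[k] γ = f) :
    heckeOp p k f ∣[k] T = heckeOp p k f := by
  rw [heckeOp, SlashAction.add_slash, SlashAction.sum_slash]
  congr 1
  · refine slash_slash_of_mul_eq hf (⟨!![1, p; 0, 1], by simp⟩) ?_
    ext a b
    fin_cases a <;> fin_cases b <;> simp [scaleMatrix, T, Matrix.mul_apply, Fin.sum_univ_two]
  · refine Fintype.sum_equiv (Equiv.addRight 1) _ _ fun j => ?_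
    have := slash_shiftMatrix_cast (p := p) hf (j.cast + 1)
    rw [Int.cast_add, ZMod.intCast_zmod_cast, Int.cast_one] at this
    rw [Equiv.coe_addRight, this]
    refine slash_slash_of_mul_eq hf (1) ?_
    ext a b
    fin_cases a <;> fin_cases b <;> simp [shiftMatrix, T, Matrix.mul_apply, Fin.sum_univ_two]
    ring

lemma heckeOp_slash_S [Fact p.Prime] (hf : ∀ γ : SL(2, ℤ), f ∣[k] γ = f) :
    heckeOp p k f ∣[k] S = heckeOp p k f := by
  have hzero : f ∣[k] shiftMatrix p (0 : ZMod p).cast = f ∣[k] shiftMatrix p 0 := by simp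
  rw [heckeOp, SlashAction.add_slash, SlashAction.sum_slash,
    ← Finset.add_sum_erase _ _ (Finset.mem_univ (0 : ZMod p)),
    ← Finset.add_sum_erase _ (fun j : ZMod p => f ∣[k] shiftMatrix p j.cast)
      (Finset.mem_univ (0 : ZMod p)), ← add_assoc, ← add_assoc, hzero,
    add_comm (f ∣[k] scaleMatrix p)]
  congr 1
  · congr 1
    · refine slash_slash_of_mul_eq hf (S) ?_
      ext a b
      fin_cases a <;> fin_cases b <;>
        simp [shiftMatrix, scaleMatrix, S, Matrix.mul_apply, Fin.sum_univ_two]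
    · refine slash_slash_of_mul_eq hf (S) ?_
      ext a b
      fin_cases a <;> fin_cases b <;>
        simp [shiftMatrix, scaleMatrix, S, Matrix.mul_apply, Fin.sum_univ_two]
  · refine Finset.sum_equiv ((Equiv.inv (ZMod p)).trans (Equiv.neg _)) (by simp) fun j hj => ?_
    have hj0 : j ≠ 0 := Finset.ne_of_mem_erase hj
    set i : ℤ := j.cast with hi
    set l : ℤ := (-j⁻¹ : ZMod p).cast with hl
    have hdvd : (p : ℤ) ∣ -1 - i * l := by
      rw [← ZMod.intCast_zmod_eq_zero_iff_dvd]
      simp [hi, hl, hj0]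
    obtain ⟨n, hn⟩ := hdvd
    refine slash_slash_of_mul_eq hf (β := shiftMatrix p l)
      ⟨!![i, n; p, -l], by rw [Matrix.det_fin_two_of]; linarith⟩ ?_
    have hn' : (-1 - i * l : ℝ) = p * n := by exact_mod_cast hn
    ext a b
    fin_cases a <;> fin_cases b <;>
      simp [shiftMatrix, S, Matrix.mul_apply, Fin.sum_univ_two]
    · linarith
    · ring

lemma coe_scaleMatrix_smul (τ : ℍ) : ((scaleMatrix p • τ : ℍ) : ℂ) = p * τ := by
  rw [coe_smul_of_det_pos (by simp [scaleMatrix, NeZero.pos p])]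
  simp [num, denom, scaleMatrix]

lemma coe_shiftMatrix_smul (j : ℤ) (τ : ℍ) :
    ((shiftMatrix p j • τ : ℍ) : ℂ) = (τ + j) / p := by
  rw [coe_smul_of_det_pos (by simp [shiftMatrix, NeZero.pos p])]
  simp [num, denom, shiftMatrix]

lemma slash_scaleMatrix_apply (τ : ℍ) :
    (f ∣[k] scaleMatrix p) τ = (p : ℂ) ^ (k - 1) * f (scaleMatrix p • τ) := by
  have hσ : σ (scaleMatrix p) = ContinuousAlgEquiv.refl ℝ ℂ := by
    rw [σ, if_pos (by simp [scaleMatrix, NeZero.pos p])]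
  rw [ModularForm.slash_apply, hσ]
  simp [denom, scaleMatrix, mul_comm]

lemma slash_shiftMatrix_apply (j : ℤ) (τ : ℍ) :
    (f ∣[k] shiftMatrix p j) τ = (p : ℂ)⁻¹ * f (shiftMatrix p j • τ) := by
  have hσ : σ (shiftMatrix p j) = ContinuousAlgEquiv.refl ℝ ℂ := by
    rw [σ, if_pos (by simp [shiftMatrix, NeZero.pos p])]
  have hp : (p : ℂ) ≠ 0 := NeZero.ne _
  rw [ModularForm.slash_apply, hσ]
  simp [denom, shiftMatrix, zpow_sub₀ hp]
  field_simp

lemma IsSumOf.comp_scaleMatrix {s : LaurentSeries ℂ} (hf : IsSumOf f s) :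
    IsSumOf (fun τ => f (scaleMatrix p • τ)) (laurentV ℂ p s) := by
  intro τ
  have hp : (p : ℤ) ≠ 0 := NeZero.ne _
  rw [← Function.Injective.hasSum_iff (mul_right_injective₀ hp)]
  · convert hf (scaleMatrix p • τ) using 2 with n
    rw [Function.comp_apply, laurentV_coeff_mul, qexp, qexp, coe_scaleMatrix_smul, _root_.zpow_mul,
      zpow_natCast, ← Complex.exp_nat_mul]
    congr 3
    ring
  · intro n hn
    rw [laurentV_coeff_of_not_dvd p s fun ⟨m, hm⟩ => hn ⟨m, hm.symm⟩, zero_mul]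

/-- The operator `∑ c(n) qⁿ ↦ ∑ c(pn) qⁿ`. -/
def laurentU (p : ℕ) [NeZero p] (s : LaurentSeries ℂ) : LaurentSeries ℂ :=
  HahnSeries.ofSuppBddBelow (fun n => s.coeff (p * n)) (by
    obtain ⟨a, ha⟩ := laurent_exists_bound s
    refine ⟨min a 0, fun n hn => not_lt.mp fun h => hn (ha _ ?_)⟩
    have hp : (1 : ℤ) ≤ p := by exact_mod_cast NeZero.one_le
    rw [lt_min_iff] at h
    nlinarith)

lemma laurentU_coeff (s : LaurentSeries ℂ) (n : ℤ) :
    (laurentU p s).coeff n = s.coeff (p * n) := rfl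

lemma sum_qexp_shiftMatrix_smul (n : ℤ) (τ : ℍ) :
    ∑ j : ZMod p, qexp (shiftMatrix p j.cast • τ) ^ n =
      if (p : ℤ) ∣ n then (p : ℂ) * qexp τ ^ (n / p) else 0 := by
  have hp : (p : ℂ) ≠ 0 := NeZero.ne _
  have h (j : ZMod p) : qexp (shiftMatrix p j.cast • τ) ^ n =
      Complex.exp (2 * π * Complex.I * n * τ / p) * ZMod.stdAddChar (j * (n : ZMod p)) := by
    have : j * (n : ZMod p) = ((j.cast * n : ℤ) : ZMod p) := by simp
    rw [this, ZMod.stdAddChar_coe, ← Complex.exp_add, qexp, coe_shiftMatrix_smul,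
      ← Complex.exp_int_mul]
    congr 1
    push_cast
    field_simp
  simp only [h, ← Finset.mul_sum]
  rw [AddChar.sum_mulShift _ (ZMod.isPrimitive_stdAddChar p), ZMod.card]
  simp only [ZMod.intCast_zmod_eq_zero_iff_dvd]
  split_ifs with hn
  · obtain ⟨m, rfl⟩ := hn
    rw [Int.mul_ediv_cancel_left _ (NeZero.ne _), mul_comm, qexp, ← Complex.exp_int_mul]
    congr 2
    push_cast
    field_simp
  · simp

lemma IsSumOf.sum_slash_shiftMatrix {s : LaurentSeries ℂ} (hf : IsSumOf f s) :
    IsSumOf (∑ j : ZMod p, f ∣[k] shiftMatrix p j.cast) (laurentU p s) := by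
  intro τ
  have hp : (p : ℂ) ≠ 0 := NeZero.ne _
  have h := hasSum_sum (s := Finset.univ) fun (j : ZMod p) _ =>
    (hf (shiftMatrix p j.cast • τ)).mul_left (p : ℂ)⁻¹
  simp only [← Finset.mul_sum, sum_qexp_shiftMatrix_smul] at h
  rw [← Function.Injective.hasSum_iff
    (mul_right_injective₀ (NeZero.ne (p : ℤ)))] at h
  · simp only [Finset.sum_apply, slash_shiftMatrix_apply, ← Finset.mul_sum]
    refine (congrArg (fun F => HasSum F _) (funext fun n => ?_)).mp h
    rw [Function.comp_apply, laurentU_coeff, if_pos (dvd_mul_right _ _),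
      Int.mul_ediv_cancel_left _ (NeZero.ne _)]
    field_simp
  · intro n hn
    rw [if_neg fun ⟨m, hm⟩ => hn ⟨m, hm.symm⟩]
    simp

lemma IsLevelOne.heckeOp [Fact p.Prime] {s : LaurentSeries ℂ} (hf : IsLevelOne k f s) :
    IsLevelOne k (heckeOp p k f)
      (HahnSeries.C ((p : ℂ) ^ (k - 1)) * laurentV ℂ p s + laurentU p s) where
  holo := (hf.holo.slash _ _).add (MDifferentiable.sum fun j _ => hf.holo.slash _ _)
  slash_eq := SlashInvariantForm.slash_action_generators_SL2Z (heckeOp_slash_S hf.slash_eq)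
    (heckeOp_slash_T hf.slash_eq)
  isSumOf := by
    refine .add ?_ hf.isSumOf.sum_slash_shiftMatrix
    convert hf.isSumOf.comp_scaleMatrix.const_smul ((p : ℂ) ^ (k - 1))
    exact funext slash_scaleMatrix_apply

/-- The Hecke relation between basis elements with principal parts `q^{-m}`, `q^{-pm}` and
`q^{-m/p}`. -/
lemma hecke_relation [Fact p.Prime] {m : ℕ} (hk : k - 12 < 0 ∨ k - 12 = 2)
    {g h : ℍ → ℂ} {s t u : LaurentSeries ℂ} (hf : IsLevelOne k f s)
    (hg : IsLevelOne k g t) (hh : IsLevelOne k h u)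
    (hs : ∀ n : ℤ, n ≤ 0 → s.coeff n = if n = -(m : ℤ) then 1 else 0)
    (ht : ∀ n : ℤ, n ≤ 0 → t.coeff n = if n = -((p * m : ℕ) : ℤ) then 1 else 0)
    (hu : ∀ n : ℤ, n ≤ 0 → u.coeff n = if p * n = -(m : ℤ) then 1 else 0) (n : ℤ) :
    (p : ℂ) ^ (k - 1) * (laurentV ℂ p s).coeff n + s.coeff (p * n) =
      (p : ℂ) ^ (k - 1) * t.coeff n + u.coeff n := by
  have hp : (0 : ℤ) < p := by exact_mod_cast NeZero.pos p
  have h0 := (((hf.heckeOp (p := p)).sub ((hg.const_smul ((p : ℂ) ^ (k - 1))).add hh)).eq_zero hk 1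
    (by push_cast; ring) fun i hi => ?_).2
  · have := congrArg (fun x => HahnSeries.coeff x n) h0
    simp only [HahnSeries.coeff_sub, HahnSeries.coeff_add, laurent_C_mul_coeff, laurentU_coeff,
      HahnSeries.coeff_zero] at this
    exact sub_eq_zero.mp this
  · have hi : i ≤ 0 := by push_cast at hi; omega
    have hV : (laurentV ℂ p s).coeff i = if i = -((p * m : ℕ) : ℤ) then 1 else 0 := by
      by_cases hd : (p : ℤ) ∣ i
      · obtain ⟨l, rfl⟩ := hd
        have hl : l ≤ 0 := by nlinarith
        rw [laurentV_coeff_mul, hs l hl]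
        refine if_congr ?_ rfl rfl
        rw [Nat.cast_mul, ← mul_neg, mul_right_inj' hp.ne']
      · rw [laurentV_coeff_of_not_dvd p s hd, if_neg]
        rintro rfl
        exact hd ⟨-m, by push_cast; ring⟩
    rw [HahnSeries.coeff_sub, HahnSeries.coeff_add, HahnSeries.coeff_add, laurent_C_mul_coeff,
      laurent_C_mul_coeff, laurentU_coeff, ht i hi, hu i hi, hs _ (by nlinarith), hV]
    ring

end Hecke

section Sturm

open Asymptotics

lemma ModularForm.eq_zero_of_isBigO_discriminant (r : ℕ) :
    ∀ {w : ℤ} (F : ModularForm 𝒮ℒ w), w < 12 * r →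
      F =O[atImInfty] (ModularForm.discriminant ^ r) → F = 0 := by
  induction r with
  | zero =>
    intro w F hw _
    exact rank_zero_iff_forall_zero.mp (ModularForm.levelOne_neg_weight_rank_zero
      (by simpa using hw)) F
  | succ r ih =>
    intro w F hw hO
    have h0 : IsZeroAtImInfty F := by
      refine hO.trans_tendsto ?_
      have h := (discriminant_isZeroAtImInfty : Filter.Tendsto _ _ _).pow (r + 1)
      rwa [zero_pow r.succ_ne_zero] at h
    have hc : (qExpansion 1 F).coeff 0 = 0 := by
      rw [qExpansion_coeff_zero one_pos
        (ModularFormClass.analyticAt_cuspFunction_zero F one_pos one_mem_strictPeriods_SL)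
        (SlashInvariantFormClass.periodic_comp_ofComplex F one_mem_strictPeriods_SL)]
      exact h0.valueAtInfty_eq_zero
    suffices CuspForm.discriminantEquiv (ModularForm.toCuspForm F hc) = 0 by
      simpa [CuspForm.discriminantEquiv.map_eq_zero_iff, DFunLike.ext_iff] using this
    refine ih _ (by push_cast at hw; linarith) ?_
    have key : (CuspForm.discriminantEquiv (ModularForm.toCuspForm F hc) : ℍ → ℂ) =
        fun z => F z * (ModularForm.discriminant z)⁻¹ := by
      funext z
      rw [CuspForm.discriminantEquiv_apply]
      simp [div_eq_mul_inv]
    rw [key]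
    refine (hO.mul (isBigO_refl (fun z => (ModularForm.discriminant z)⁻¹) _)).congr_right ?_
    intro z
    have := discriminant_ne_zero z
    simp only [Pi.pow_apply]
    field_simp
    ring

lemma card_quotient_Gamma0_le (p : ℕ) [Fact p.Prime] : (Gamma0 p).index ≤ p + 1 := by
  classical
  let φ : SL(2, ℤ) → Option (ZMod p) := fun g =>
    if (g 1 0 : ZMod p) = 0 then none else some ((g 0 0 : ZMod p) / (g 1 0 : ZMod p))
  have hdet (g : SL(2, ℤ)) : (g 0 0 * g 1 1 - g 0 1 * g 1 0 : ZMod p) = 1 := by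
    have := g.det_coe
    rw [Matrix.det_fin_two] at this
    exact_mod_cast congrArg (Int.cast : ℤ → ZMod p) this
  have hmem (g h : SL(2, ℤ)) : g⁻¹ * h ∈ Gamma0 p ↔
      (g 0 0 * h 1 0 : ZMod p) = g 1 0 * h 0 0 := by
    rw [Gamma0_mem]
    have : (g⁻¹ * h) 1 0 = -g 1 0 * h 0 0 + g 0 0 * h 1 0 := by
      rw [Matrix.SpecialLinearGroup.coe_mul, Matrix.SpecialLinearGroup.coe_inv,
        Matrix.adjugate_fin_two, Matrix.mul_apply, Fin.sum_univ_two]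
      simp
    rw [this]
    push_cast
    constructor <;> intro h <;> linear_combination h
  have hφ (g h : SL(2, ℤ)) : φ g = φ h ↔ g⁻¹ * h ∈ Gamma0 p := by
    rw [hmem]
    have hg := hdet g
    have hh := hdet h
    simp only [φ]
    split_ifs with h1 h2 h2
    · simp [h1, h2]
    · simp only [h1, zero_mul, mul_eq_zero, h2, or_false, false_iff]
      intro h3
      simp [h1, h3] at hg
    · simp only [h2, mul_zero, zero_eq_mul, h1, false_or, false_iff]
      intro h3
      simp [h2, h3] at hh
    · rw [Option.some_inj, div_eq_div_iff h1 h2, mul_comm (h 0 0 : ZMod p)]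
  have hinj : Function.Injective (fun q : SL(2, ℤ) ⧸ Gamma0 p =>
      Quotient.liftOn' q φ fun g h hgh => (hφ g h).2 (QuotientGroup.leftRel_apply.mp hgh)) := by
    rintro ⟨g⟩ ⟨h⟩ hgh
    exact QuotientGroup.eq.mpr ((hφ g h).1 hgh)
  calc (Gamma0 p).index = Nat.card (SL(2, ℤ) ⧸ Gamma0 p) := rfl
    _ ≤ Nat.card (Option (ZMod p)) := Nat.card_le_card_of_injective _ hinj
    _ = p + 1 := by simp

lemma relIndex_Gamma0_le (p : ℕ) [Fact p.Prime] :
    ((Gamma0 p).map (Matrix.SpecialLinearGroup.mapGL ℝ)).relIndex 𝒮ℒ ≤ p + 1 := by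
  rw [MonoidHom.range_eq_map, Subgroup.relIndex_map_map_of_injective _ _
    Matrix.SpecialLinearGroup.mapGL_injective, Subgroup.relIndex_top_right]
  exact card_quotient_Gamma0_le p

lemma IsSumOf.isBigO_discriminant_pow {f : ℍ → ℂ} {s : LaurentSeries ℂ} (hf : IsSumOf f s)
    (r : ℕ) (hs : ∀ n < (r : ℤ), s.coeff n = 0) :
    f =O[atImInfty] (ModularForm.discriminant ^ r) := by
  have hsum (τ : ℍ) : HasSum (fun n : ℕ => s.coeff (n + r : ℕ) • Function.Periodic.qParam 1 τ ^ n)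
      (f τ * (Function.Periodic.qParam 1 τ ^ r)⁻¹) := by
    have h := (hasSum_nat_add_iff' r).2
      (hf.hasSum_nat (fun n hn => hs n (by omega)) τ)
    rw [Finset.sum_eq_zero fun i hi => by
      rw [hs i (by exact_mod_cast Finset.mem_range.mp hi), zero_smul], sub_zero] at h
    refine (congrArg (fun F => HasSum F _) (funext fun n => ?_)).mp
      (h.mul_right (Function.Periodic.qParam 1 τ ^ r)⁻¹)
    have : Function.Periodic.qParam 1 (τ : ℂ) ≠ 0 := Complex.exp_ne_zero _
    simp only [smul_eq_mul, pow_add]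
    field_simp
  have hb : _ =O[atImInfty] (1 : ℍ → ℂ) :=
    IsBigO.trans (isBoundedAtImInfty_of_hasSum_qExpansion one_pos hsum)
      (isBigO_of_le _ fun _ => by simp)
  have hq : (fun τ : ℍ => Function.Periodic.qParam 1 (τ : ℂ)) =O[atImInfty]
      ModularForm.discriminant := by
    rw [← isBigO_norm_left]
    simpa [Function.Periodic.norm_qParam] using ModularForm.exp_isBigO_discriminant
  refine ((IsBigO.mul hb (hq.pow r)).congr_left fun τ => ?_).congr_right fun τ => ?_
  · have : Function.Periodic.qParam 1 (τ : ℂ) ≠ 0 := Complex.exp_ne_zero _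
    field_simp
  · simp

/-- Sturm's bound at level `p`. -/
lemma sturm (p : ℕ) [Fact p.Prime] {k : ℤ} (hk : 0 ≤ k)
    (f : ModularForm ((Gamma0 p).map (Matrix.SpecialLinearGroup.mapGL ℝ)) k)
    {s : LaurentSeries ℂ} (hf : IsSumOf f s) (r : ℕ) (hs : ∀ n < (r : ℤ), s.coeff n = 0)
    (hr : k * (p + 1) < 12 * r) : (f : ℍ → ℂ) = 0 := by
  rw [← ModularForm.norm_eq_zero_iff 𝒮ℒ]
  refine ModularForm.eq_zero_of_isBigO_discriminant r _ ?_ ?_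
  · refine lt_of_le_of_lt (mul_le_mul_of_nonneg_left ?_ hk) hr
    exact_mod_cast relIndex_Gamma0_le p
  · classical
    rw [ModularForm.coe_norm]
    let := Fintype.ofFinite (𝒮ℒ ⧸
      ((Gamma0 p).map (Matrix.SpecialLinearGroup.mapGL ℝ)).subgroupOf 𝒮ℒ)
    rw [← Finset.mul_prod_erase _ _ (Finset.mem_univ (⟦1⟧ : _ ⧸ _))]
    have h1 : (∏ q ∈ (Finset.univ : Finset (𝒮ℒ ⧸ ((Gamma0 p).map
        (Matrix.SpecialLinearGroup.mapGL ℝ)).subgroupOf 𝒮ℒ)).erase ⟦1⟧,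
        SlashInvariantForm.quotientFunc f q) =O[atImInfty] (1 : ℍ → ℂ) := by
      rw [show (1 : ℍ → ℂ) = (fun x ↦ ∏ (i ∈ (Finset.univ : Finset (𝒮ℒ ⧸ ((Gamma0 p).map
        (Matrix.SpecialLinearGroup.mapGL ℝ)).subgroupOf 𝒮ℒ)).erase ⟦1⟧), 1) by ext; simp,
        Finset.prod_fn]
      refine .finsetProd fun q _ => ?_
      obtain ⟨⟨_, γ, rfl⟩, rfl⟩ := Quotient.exists_rep q
      have := ModularFormClass.bdd_at_infty_slash f γ⁻¹
      rw [ModularForm.SL_slash] at this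
      rw [SlashInvariantForm.quotientFunc_mk]
      refine IsBigO.trans ?_ (isBigO_of_le _ fun _ => by simp : (1 : ℍ → ℝ) =O[_] _)
      rw [← map_inv]
      exact this
    refine (IsBigO.mul (hf.isBigO_discriminant_pow r hs) h1).congr' ?_ ?_
    · refine .of_forall fun τ => ?_
      simp
    · refine .of_forall fun τ => ?_
      simp
end Sturm

section Level

open Matrix.SpecialLinearGroup

/-- `s` is the `q`-expansion of a modular form for `Γ₀(p)` of weight `k`. -/
def IsLevel (p : ℕ) (k : ℤ) (s : LaurentSeries ℂ) : Prop :=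
  ∃ G : ModularForm ((Gamma0 p).map (mapGL ℝ)) k, IsSumOf G s

/-- Restriction of a modular form to a subgroup. -/
def ModularForm.restrict {Γ Γ' : Subgroup (GL (Fin 2) ℝ)} {k : ℤ} (F : ModularForm Γ k)
    (h : Γ' ≤ Γ) : ModularForm Γ' k where
  toFun := F
  holo' := F.holo'
  bdd_at_cusps' hc := F.bdd_at_cusps' (hc.mono h)
  slash_action_eq' γ hγ := F.slash_action_eq' γ (h hγ)

namespace IsLevel

variable {p : ℕ} {k l : ℤ} {s t : LaurentSeries ℂ}

lemma add (hs : IsLevel p k s) (ht : IsLevel p k t) : IsLevel p k (s + t) := by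
  obtain ⟨F, hF⟩ := hs
  obtain ⟨G, hG⟩ := ht
  exact ⟨F + G, hF.add hG⟩

lemma sub (hs : IsLevel p k s) (ht : IsLevel p k t) : IsLevel p k (s - t) := by
  obtain ⟨F, hF⟩ := hs
  obtain ⟨G, hG⟩ := ht
  exact ⟨F - G, hF.sub hG⟩

lemma const_mul (hs : IsLevel p k s) (c : ℂ) : IsLevel p k (HahnSeries.C c * s) := by
  obtain ⟨F, hF⟩ := hs
  exact ⟨c • F, hF.const_smul c⟩

lemma intCast_mul (hs : IsLevel p k s) (c : ℤ) : IsLevel p k (c * s) := by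
  simpa using hs.const_mul c

lemma mul (hs : IsLevel p k s) (ht : IsLevel p l t) : IsLevel p (k + l) (s * t) := by
  obtain ⟨F, hF⟩ := hs
  obtain ⟨G, hG⟩ := ht
  exact ⟨F.mul G, hF.mul hG⟩

lemma eq_zero [Fact p.Prime] (hs : IsLevel p k s) (hk : 0 ≤ k) (r : ℕ)
    (h : ∀ n < (r : ℤ), s.coeff n = 0) (hr : k * (p + 1) < 12 * r) : s = 0 := by
  obtain ⟨F, hF⟩ := hs
  have := sturm p hk F hF r h hr
  rw [this] at hF
  exact hF.eq_zero

end IsLevel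

open Pointwise in
lemma Gamma0_le_conj_scaleMatrix (p : ℕ) [NeZero p] :
    (Gamma0 p).map (mapGL ℝ) ≤ ConjAct.toConjAct (scaleMatrix p)⁻¹ • 𝒮ℒ := by
  rintro _ ⟨γ, hγ, rfl⟩
  obtain ⟨c, hc⟩ := (ZMod.intCast_zmod_eq_zero_iff_dvd _ p).mp (Gamma0_mem.mp hγ)
  rw [Subgroup.mem_pointwise_smul_iff_inv_smul_mem, ConjAct.smul_def]
  have hdet := γ.det_coe
  rw [Matrix.det_fin_two, hc] at hdet
  obtain ⟨δ, hδ⟩ : ∃ δ : SL(2, ℤ), δ.1 = !![γ 0 0, p * γ 0 1; c, γ 1 1] :=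
    ⟨⟨!![γ 0 0, p * γ 0 1; c, γ 1 1], by
      rw [Matrix.det_fin_two_of]
      linear_combination hdet⟩, rfl⟩
  refine ⟨δ, ?_⟩
  rw [ConjAct.ofConjAct_inv, ConjAct.ofConjAct_toConjAct, inv_inv, eq_mul_inv_iff_mul_eq]
  refine Units.ext ?_
  rw [Units.val_mul, Units.val_mul, mapGL_coe_matrix, mapGL_coe_matrix]
  have hc' : ((γ 1 0 : ℤ) : ℝ) = p * c := by exact_mod_cast hc
  ext a b
  fin_cases a <;> fin_cases b <;>
    simp [scaleMatrix, Matrix.mul_apply, Fin.sum_univ_two, hc', hδ, mul_comm]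

namespace IsLevelOne

variable {k : ℤ} {f : ℍ → ℂ} {s : LaurentSeries ℂ}

lemma isLevel (p : ℕ) (hf : IsLevelOne k f s) (hs : ∀ n < 0, s.coeff n = 0) : IsLevel p k s := by
  obtain ⟨F, rfl, -⟩ := hf.exists_modularForm hs
  exact ⟨F.restrict (Subgroup.map_le_range _ _), hf.isSumOf⟩

lemma isLevel_laurentV (p : ℕ) [NeZero p] (hf : IsLevelOne k f s) (hs : ∀ n < 0, s.coeff n = 0) :
    IsLevel p k (laurentV ℂ p s) := by
  obtain ⟨F, rfl, -⟩ := hf.exists_modularForm hs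
  have h : IsSumOf ((ModularForm.translate F (scaleMatrix p)).restrict
      (Gamma0_le_conj_scaleMatrix p)) (HahnSeries.C ((p : ℂ) ^ (k - 1)) * laurentV ℂ p s) := by
    convert hf.isSumOf.comp_scaleMatrix.const_smul ((p : ℂ) ^ (k - 1)) using 1
    funext τ
    exact slash_scaleMatrix_apply τ
  have h2 : IsLevel p k _ := IsLevel.const_mul ⟨_, h⟩ ((p : ℂ) ^ (k - 1))⁻¹
  rwa [← mul_assoc, ← map_mul, inv_mul_cancel₀ (zpow_ne_zero _ (NeZero.ne _)), map_one,
    one_mul] at h2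

end IsLevelOne

end Level

section Relations

open PowerSeries in
lemma mk_span_X_pow_eq_sum {R : Type*} [CommRing R] {r N : ℕ} (hr : r ≤ N) (f : R⟦X⟧) :
    Ideal.Quotient.mk (Ideal.span {(X : R⟦X⟧) ^ r}) f =
      ∑ i ∈ Finset.range N, Ideal.Quotient.mk _ (C (coeff i f)) * Ideal.Quotient.mk _ X ^ i := by
  simp_rw [← map_pow, ← map_mul, ← map_sum]
  rw [Ideal.Quotient.eq, Ideal.mem_span_singleton, X_pow_dvd_iff]
  intro m hm
  simp [coeff_C_mul, coeff_X_pow, hm.trans_le hr]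

/-- The power series `∑ σ_k(n) q^{pn}`. -/
def dilatedDivisorSeries (p k : ℕ) [NeZero p] : PowerSeries ℤ :=
  PowerSeries.mk fun n => if p ∣ n then (ArithmeticFunction.sigma k (n / p) : ℤ) else 0

lemma ofPowerSeries_dilatedDivisorSeries (p k : ℕ) [NeZero p] :
    HahnSeries.ofPowerSeries ℤ ℤ (dilatedDivisorSeries p k) = laurentV ℤ p (divisorSeries k) := by
  ext n
  rw [laurentV_coeff]
  rcases lt_or_ge n 0 with h0 | h0
  · rw [ofPowerSeries_coeff_of_neg _ h0]
    split_ifs with h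
    · exact (ofPowerSeries_coeff_of_neg _ (Int.ediv_neg_of_neg_of_pos h0
        (by exact_mod_cast NeZero.pos p))).symm
    · rfl
  · lift n to ℕ using h0
    rw [ofPowerSeries_coeff_natCast, dilatedDivisorSeries, PowerSeries.coeff_mk]
    simp only [Int.natCast_dvd_natCast]
    split_ifs
    · rw [← Int.natCast_div, divisorSeries_coeff]
    · rfl

lemma laurentV_one (s : LaurentSeries ℤ) : laurentV ℤ 1 s = s := by
  ext n
  simp [laurentV_coeff]

/-- `s` is the integral `q`-expansion of a modular form for `Γ₀(p)` of weight `k`. -/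
def IsIntLevel (p : ℕ) (k : ℤ) (s : LaurentSeries ℤ) : Prop := IsLevel p k (laurentComplex s)

namespace IsIntLevel

variable {p : ℕ} {k l : ℤ} {s t : LaurentSeries ℤ}

lemma add (hs : IsIntLevel p k s) (ht : IsIntLevel p k t) : IsIntLevel p k (s + t) := by
  rw [IsIntLevel, map_add]; exact IsLevel.add hs ht

lemma sub (hs : IsIntLevel p k s) (ht : IsIntLevel p k t) : IsIntLevel p k (s - t) := by
  rw [IsIntLevel, map_sub]; exact IsLevel.sub hs ht

lemma mul (hs : IsIntLevel p k s) (ht : IsIntLevel p l t) : IsIntLevel p (k + l) (s * t) := by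
  rw [IsIntLevel, map_mul]; exact IsLevel.mul hs ht

lemma intCast_mul (hs : IsIntLevel p k s) (c : ℤ) : IsIntLevel p k (c * s) := by
  rw [IsIntLevel, map_mul, map_intCast]; exact IsLevel.intCast_mul hs c

lemma of_intCast_mul {c : ℤ} (hc : c ≠ 0) (hs : IsIntLevel p k (c * s)) : IsIntLevel p k s := by
  rw [IsIntLevel, map_mul, map_intCast] at hs
  have h := IsLevel.const_mul hs (c : ℂ)⁻¹
  rwa [← mul_assoc, ← map_intCast (HahnSeries.C (Γ := ℤ)), ← map_mul,
    inv_mul_cancel₀ (Int.cast_ne_zero.mpr hc), map_one, one_mul] at h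

lemma _root_.IsLevelOne.isIntLevel {f : ℍ → ℂ} (hf : IsLevelOne k f (laurentComplex s))
    (hs : IsMonicAt s 0) : IsIntLevel p k s :=
  hf.isLevel p (hs.map _).1

lemma _root_.IsLevelOne.isIntLevel_laurentV [NeZero p] {f : ℍ → ℂ}
    (hf : IsLevelOne k f (laurentComplex s)) (hs : IsMonicAt s 0) :
    IsIntLevel p k (laurentV ℤ p s) := by
  rw [IsIntLevel, laurentComplex, laurentMap_laurentV]
  exact hf.isLevel_laurentV p (hs.map _).1

lemma eq_zero_of_mk [Fact p.Prime] (hs : IsIntLevel p k s) (hk : 0 ≤ k) (r : ℕ)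
    (hr : k * (p + 1) < 12 * r) (f : PowerSeries ℤ) (hf : HahnSeries.ofPowerSeries ℤ ℤ f = s)
    (h : Ideal.Quotient.mk (Ideal.span {(PowerSeries.X : PowerSeries ℤ) ^ r}) f = 0) : s = 0 := by
  subst hf
  rw [Ideal.Quotient.eq_zero_iff_mem, Ideal.mem_span_singleton, PowerSeries.X_pow_dvd_iff] at h
  refine laurentComplex_injective ?_
  rw [map_zero]
  refine IsLevel.eq_zero hs hk r (fun n hn => ?_) hr
  rw [laurentMap_coeff]
  rcases lt_or_ge n 0 with h0 | h0
  · rw [ofPowerSeries_coeff_of_neg _ h0, map_zero]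
  · lift n to ℕ using h0
    rw [ofPowerSeries_coeff_natCast, h n (by exact_mod_cast hn), map_zero]

variable (p)

lemma eis4 : IsIntLevel p 4 eis4 := isLevelOne_eis4.isIntLevel isMonicAt_eis4

lemma eis6 : IsIntLevel p 6 eis6 := isLevelOne_eis6.isIntLevel isMonicAt_eis6

variable [NeZero p]

lemma eis4_V : IsIntLevel p 4 (laurentV ℤ p _root_.eis4) :=
  isLevelOne_eis4.isIntLevel_laurentV isMonicAt_eis4

lemma eis6_V : IsIntLevel p 6 (laurentV ℤ p _root_.eis6) :=
  isLevelOne_eis6.isIntLevel_laurentV isMonicAt_eis6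

lemma gamma : IsIntLevel p 4 (gammaSeries p) := by
  refine of_intCast_mul (c := 240) (by norm_num) ?_
  convert (eis4 p).sub (eis4_V p) using 1
  simp only [gammaSeries, _root_.eis4, map_add, map_mul, map_one, map_ofNat]
  push_cast
  ring

lemma betaTwo : IsIntLevel 2 4 betaTwo := by
  convert (eis4_V 2).sub ((gamma 2).intCast_mul 16) using 1
  rw [laurentV_eis4_two]
  push_cast
  ring

lemma betaThree : IsIntLevel 3 4 betaThree := by
  convert (eis4_V 3).sub ((gamma 3).intCast_mul 3) using 1
  rw [laurentV_eis4_three]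
  push_cast
  ring

end IsIntLevel

lemma laurentV_discSeries_eq (p : ℕ) [NeZero p] : 1728 * laurentV ℤ p discSeries =
    laurentV ℤ p eis4 ^ 3 - laurentV ℤ p eis6 ^ 2 := by
  rw [← map_pow, ← map_pow, ← map_sub, ← discSeries_eq, map_mul, map_ofNat]

section Truncation

variable {r : ℕ} {x : PowerSeries ℤ ⧸ Ideal.span {(PowerSeries.X : PowerSeries ℤ) ^ r}}

lemma sigma_values (k : ℕ) : ArithmeticFunction.sigma k 1 = 1 ∧
    ArithmeticFunction.sigma k 2 = 1 + 2 ^ k ∧ ArithmeticFunction.sigma k 3 = 1 + 3 ^ k ∧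
    ArithmeticFunction.sigma k 4 = 1 + 2 ^ k + 4 ^ k ∧
    ArithmeticFunction.sigma k 5 = 1 + 5 ^ k := by
  simp_rw [ArithmeticFunction.sigma_apply, show Nat.divisors 1 = {1} by decide,
    show Nat.divisors 2 = {1, 2} by decide, show Nat.divisors 3 = {1, 3} by decide,
    show Nat.divisors 4 = {1, 2, 4} by decide, show Nat.divisors 5 = {1, 5} by decide]
  simp [add_assoc]

/-- The truncations of the series `∑ σ_k(n) q^{pn}` at `q⁶`. -/
lemma mk_dilatedDivisorSeries (hr : r ≤ 6) (hX : Ideal.Quotient.mk _ PowerSeries.X = x) (k : ℕ) :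
    Ideal.Quotient.mk _ (dilatedDivisorSeries 1 k) =
        x + (1 + 2 ^ k) * x ^ 2 + (1 + 3 ^ k) * x ^ 3 + (1 + 2 ^ k + 4 ^ k) * x ^ 4
          + (1 + 5 ^ k) * x ^ 5 ∧
      Ideal.Quotient.mk _ (dilatedDivisorSeries 2 k) = x ^ 2 + (1 + 2 ^ k) * x ^ 4 ∧
      Ideal.Quotient.mk _ (dilatedDivisorSeries 3 k) = x ^ 3 := by
  obtain ⟨-, h2, h3, h4, h5⟩ := sigma_values k
  simp_rw [mk_span_X_pow_eq_sum hr (dilatedDivisorSeries _ k), hX]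
  simp [Finset.sum_range_succ, dilatedDivisorSeries, h2, h3, h4, h5, map_ofNat]

end Truncation

lemma level_two_disc : 1728 * (betaTwo ^ 2 * gammaSeries 2) - (eis4 ^ 3 - eis6 ^ 2) = 0 := by
  refine IsIntLevel.eq_zero_of_mk (p := 2) (k := 12) ?_ (by norm_num) 4 (by norm_num)
    (1728 * ((1 + 256 * dilatedDivisorSeries 2 3 - 16 * dilatedDivisorSeries 1 3) ^ 2 *
      (dilatedDivisorSeries 1 3 - dilatedDivisorSeries 2 3)) - ((1 + 240 * dilatedDivisorSeries 1
      3) ^ 3 - (1 - 504 * dilatedDivisorSeries 1 5) ^ 2)) ?_ ?_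
  · have b := IsIntLevel.betaTwo
    have g := IsIntLevel.gamma 2
    have e4 := IsIntLevel.eis4 2
    have e6 := IsIntLevel.eis6 2
    convert (((b.mul b).mul g).intCast_mul 1728).sub
      (((e4.mul e4).mul e4).sub (e6.mul e6)) using 1
    push_cast
    ring
  · simp only [map_sub, map_add, map_mul, map_pow, map_one, map_ofNat,
      ofPowerSeries_dilatedDivisorSeries, laurentV_one, eis4, eis6, betaTwo, gammaSeries]
  · obtain ⟨x, hX⟩ : ∃ x, Ideal.Quotient.mk
        (Ideal.span {(PowerSeries.X : PowerSeries ℤ) ^ 4}) PowerSeries.X = x := ⟨_, rfl⟩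
    have hx : x ^ 4 = 0 := by
      rw [← hX, ← map_pow, Ideal.Quotient.eq_zero_iff_mem]
      exact Ideal.mem_span_singleton_self _
    obtain ⟨h31, h32, -⟩ := mk_dilatedDivisorSeries (by norm_num) hX 3
    obtain ⟨h51, -⟩ := mk_dilatedDivisorSeries (by norm_num) hX 5
    simp only [map_sub, map_add, map_mul, map_pow, map_one, map_ofNat, h31, h32, h51]
    linear_combination (7910784 * x ^ 2 - 3985438464 * x ^ 3 - 132204996288 * x ^ 4 -
      1089779947776 * x ^ 5 - 5289022759680 * x ^ 6 - 17765387845632 * x ^ 7 - 32808070656000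
      * x ^ 8 - 45917643792384 * x ^ 9 - 48611688136704 * x ^ 10 - 26768295493632 * x ^ 11) *
      hx

lemma level_two_disc_V : 1728 * (betaTwo * gammaSeries 2 ^ 2) - (laurentV ℤ 2 eis4 ^ 3 - laurentV
    ℤ 2 eis6 ^ 2) = 0 := by
  refine IsIntLevel.eq_zero_of_mk (p := 2) (k := 12) ?_ (by norm_num) 4 (by norm_num)
    (1728 * ((1 + 256 * dilatedDivisorSeries 2 3 - 16 * dilatedDivisorSeries 1 3) *
      (dilatedDivisorSeries 1 3 - dilatedDivisorSeries 2 3) ^ 2) - ((1 + 240 *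
      dilatedDivisorSeries 2 3) ^ 3 - (1 - 504 * dilatedDivisorSeries 2 5) ^ 2)) ?_ ?_
  · have b := IsIntLevel.betaTwo
    have g := IsIntLevel.gamma 2
    have v4 := IsIntLevel.eis4_V 2
    have v6 := IsIntLevel.eis6_V 2
    convert (((b.mul g).mul g).intCast_mul 1728).sub
      (((v4.mul v4).mul v4).sub (v6.mul v6)) using 1
    push_cast
    ring
  · simp only [map_sub, map_add, map_mul, map_pow, map_one, map_ofNat,
      ofPowerSeries_dilatedDivisorSeries, laurentV_one, eis4, eis6, betaTwo, gammaSeries]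
  · obtain ⟨x, hX⟩ : ∃ x, Ideal.Quotient.mk
        (Ideal.span {(PowerSeries.X : PowerSeries ℤ) ^ 4}) PowerSeries.X = x := ⟨_, rfl⟩
    have hx : x ^ 4 = 0 := by
      rw [← hX, ← map_pow, Ideal.Quotient.eq_zero_iff_mem]
      exact Ideal.mem_span_singleton_self _
    obtain ⟨h31, h32, -⟩ := mk_dilatedDivisorSeries (by norm_num) hX 3
    obtain ⟨-, h52, -⟩ := mk_dilatedDivisorSeries (by norm_num) hX 5
    simp only [map_sub, map_add, map_mul, map_pow, map_one, map_ofNat, h31, h32, h52]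
    linear_combination (266112 * x ^ 2 - 774144 * x ^ 3 - 113579712 * x ^ 4 - 78741504 * x ^ 5
      - 3917382912 * x ^ 6 - 2134315008 * x ^ 7 - 17107476480 * x ^ 8 - 19480559616 * x ^ 9 -
      25019559936 * x ^ 10 - 55306395648 * x ^ 11) * hx

lemma level_two_eis6 : eis6 * (betaTwo - 8 * gammaSeries 2) - laurentV ℤ 2 eis6 * (betaTwo - 512 *
    gammaSeries 2) = 0 := by
  refine IsIntLevel.eq_zero_of_mk (p := 2) (k := 10) ?_ (by norm_num) 3 (by norm_num)
    ((1 - 504 * dilatedDivisorSeries 1 5) * ((1 + 256 * dilatedDivisorSeries 2 3 - 16 *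
      dilatedDivisorSeries 1 3) - 8 * (dilatedDivisorSeries 1 3 - dilatedDivisorSeries 2 3)) - (1
      - 504 * dilatedDivisorSeries 2 5) * ((1 + 256 * dilatedDivisorSeries 2 3 - 16 *
      dilatedDivisorSeries 1 3) - 512 * (dilatedDivisorSeries 1 3 - dilatedDivisorSeries 2 3))) ?_
      ?_
  · have b := IsIntLevel.betaTwo
    have g := IsIntLevel.gamma 2
    have e6 := IsIntLevel.eis6 2
    have v6 := IsIntLevel.eis6_V 2
    convert (e6.mul (b.sub (g.intCast_mul 8))).sub (v6.mul (b.sub (g.intCast_mul 512))) using 1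
    push_cast
    ring
  · simp only [map_sub, map_add, map_mul, map_one, map_ofNat,
      ofPowerSeries_dilatedDivisorSeries, laurentV_one, eis6, betaTwo, gammaSeries]
  · obtain ⟨x, hX⟩ : ∃ x, Ideal.Quotient.mk
        (Ideal.span {(PowerSeries.X : PowerSeries ℤ) ^ 3}) PowerSeries.X = x := ⟨_, rfl⟩
    have hx : x ^ 3 = 0 := by
      rw [← hX, ← map_pow, Ideal.Quotient.eq_zero_iff_mem]
      exact Ideal.mem_span_singleton_self _
    obtain ⟨h31, h32, -⟩ := mk_dilatedDivisorSeries (by norm_num) hX 3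
    obtain ⟨h51, h52, -⟩ := mk_dilatedDivisorSeries (by norm_num) hX 5
    simp only [map_sub, map_add, map_mul, map_one, map_ofNat, h31, h32, h51, h52]
    linear_combination (3822336 * x ^ 3 - 23490432 * x ^ 4 + 572092416 * x ^ 5 - 478638720 * x
      ^ 6 + 4764324096 * x ^ 7) * hx

lemma level_three_disc : 1728 * (betaThree ^ 3 * gammaSeries 3) - (betaThree + 27 * gammaSeries 3)
    * (eis4 ^ 3 - eis6 ^ 2) = 0 := by
  refine IsIntLevel.eq_zero_of_mk (p := 3) (k := 16) ?_ (by norm_num) 6 (by norm_num)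
    (1728 * ((1 + 243 * dilatedDivisorSeries 3 3 - 3 * dilatedDivisorSeries 1 3) ^ 3 *
      (dilatedDivisorSeries 1 3 - dilatedDivisorSeries 3 3)) - ((1 + 243 * dilatedDivisorSeries 3
      3 - 3 * dilatedDivisorSeries 1 3) + 27 * (dilatedDivisorSeries 1 3 - dilatedDivisorSeries 3
      3)) * ((1 + 240 * dilatedDivisorSeries 1 3) ^ 3 - (1 - 504 * dilatedDivisorSeries 1 5) ^ 2))
      ?_ ?_
  · have b := IsIntLevel.betaThree
    have g := IsIntLevel.gamma 3
    have e4 := IsIntLevel.eis4 3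
    have e6 := IsIntLevel.eis6 3
    convert ((((b.mul b).mul b).mul g).intCast_mul 1728).sub
      ((b.add (g.intCast_mul 27)).mul (((e4.mul e4).mul e4).sub (e6.mul e6))) using 1
    push_cast
    ring
  · simp only [map_sub, map_add, map_mul, map_pow, map_one, map_ofNat,
      ofPowerSeries_dilatedDivisorSeries, laurentV_one, eis4, eis6, betaThree, gammaSeries]
  · obtain ⟨x, hX⟩ : ∃ x, Ideal.Quotient.mk
        (Ideal.span {(PowerSeries.X : PowerSeries ℤ) ^ 6}) PowerSeries.X = x := ⟨_, rfl⟩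
    have hx : x ^ 6 = 0 := by
      rw [← hX, ← map_pow, Ideal.Quotient.eq_zero_iff_mem]
      exact Ideal.mem_span_singleton_self _
    obtain ⟨h31, -, h33⟩ := mk_dilatedDivisorSeries (by norm_num) hX 3
    obtain ⟨h51, -⟩ := mk_dilatedDivisorSeries (by norm_num) hX 5
    simp only [map_sub, map_add, map_mul, map_pow, map_one, map_ofNat, h31, h33, h51]
    linear_combination (7877952 - 3777667200 * x - 226331212608 * x ^ 2 - 5112698832000 * x ^
      3 - 63547900382592 * x ^ 4 - 504425275695936 * x ^ 5 - 2812893877346688 * x ^ 6 -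
      11676484653607296 * x ^ 7 - 36577136930424192 * x ^ 8 - 87355268261823744 * x ^ 9 -
      163227637241884224 * x ^ 10 - 228510516809304576 * x ^ 11 - 248732126125604352 * x ^ 12
      - 193820862577047552 * x ^ 13 - 83635029742150656 * x ^ 14) * hx

lemma level_three_disc_V : 1728 * (betaThree * gammaSeries 3 ^ 3) - (betaThree + 27 * gammaSeries
    3) * (laurentV ℤ 3 eis4 ^ 3 - laurentV ℤ 3 eis6 ^ 2) = 0 := by
  refine IsIntLevel.eq_zero_of_mk (p := 3) (k := 16) ?_ (by norm_num) 6 (by norm_num)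
    (1728 * ((1 + 243 * dilatedDivisorSeries 3 3 - 3 * dilatedDivisorSeries 1 3) *
      (dilatedDivisorSeries 1 3 - dilatedDivisorSeries 3 3) ^ 3) - ((1 + 243 *
      dilatedDivisorSeries 3 3 - 3 * dilatedDivisorSeries 1 3) + 27 * (dilatedDivisorSeries 1 3 -
      dilatedDivisorSeries 3 3)) * ((1 + 240 * dilatedDivisorSeries 3 3) ^ 3 - (1 - 504 *
      dilatedDivisorSeries 3 5) ^ 2)) ?_ ?_
  · have b := IsIntLevel.betaThree
    have g := IsIntLevel.gamma 3
    have v4 := IsIntLevel.eis4_V 3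
    have v6 := IsIntLevel.eis6_V 3
    convert ((((b.mul g).mul g).mul g).intCast_mul 1728).sub
      ((b.add (g.intCast_mul 27)).mul (((v4.mul v4).mul v4).sub (v6.mul v6))) using 1
    push_cast
    ring
  · simp only [map_sub, map_add, map_mul, map_pow, map_one, map_ofNat,
      ofPowerSeries_dilatedDivisorSeries, laurentV_one, eis4, eis6, betaThree, gammaSeries]
  · obtain ⟨x, hX⟩ : ∃ x, Ideal.Quotient.mk
        (Ideal.span {(PowerSeries.X : PowerSeries ℤ) ^ 6}) PowerSeries.X = x := ⟨_, rfl⟩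
    have hx : x ^ 6 = 0 := by
      rw [← hX, ← map_pow, Ideal.Quotient.eq_zero_iff_mem]
      exact Ideal.mem_span_singleton_self _
    obtain ⟨h31, -, h33⟩ := mk_dilatedDivisorSeries (by norm_num) hX 3
    obtain ⟨-, -, h53⟩ := mk_dilatedDivisorSeries (by norm_num) hX 5
    simp only [map_sub, map_add, map_mul, map_pow, map_one, map_ofNat, h31, h33, h53]
    linear_combination (39744 + 953856 * x + 7324992 * x ^ 2 + 12562560 * x ^ 3 - 400215168 *
      x ^ 4 - 3517069248 * x ^ 5 - 16767205632 * x ^ 6 - 49538107008 * x ^ 7 - 148139051904 *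
      x ^ 8 - 362415368448 * x ^ 9 - 956621192256 * x ^ 10 - 1894387751424 * x ^ 11 -
      2921856634368 * x ^ 12 - 3028025161728 * x ^ 13 - 1306613597184 * x ^ 14) * hx

lemma level_three_eis6 : eis6 * (betaThree ^ 2 + 18 * betaThree * gammaSeries 3 - 27 * gammaSeries
    3 ^ 2) - laurentV ℤ 3 eis6 * (betaThree ^ 2 - 486 * betaThree * gammaSeries 3 - 19683 *
    gammaSeries 3 ^ 2) = 0 := by
  refine IsIntLevel.eq_zero_of_mk (p := 3) (k := 14) ?_ (by norm_num) 5 (by norm_num)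
    ((1 - 504 * dilatedDivisorSeries 1 5) * ((1 + 243 * dilatedDivisorSeries 3 3 - 3 *
      dilatedDivisorSeries 1 3) ^ 2 + 18 * (1 + 243 * dilatedDivisorSeries 3 3 - 3 *
      dilatedDivisorSeries 1 3) * (dilatedDivisorSeries 1 3 - dilatedDivisorSeries 3 3) - 27 *
      (dilatedDivisorSeries 1 3 - dilatedDivisorSeries 3 3) ^ 2) - (1 - 504 * dilatedDivisorSeries
      3 5) * ((1 + 243 * dilatedDivisorSeries 3 3 - 3 * dilatedDivisorSeries 1 3) ^ 2 - 486 * (1 +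
      243 * dilatedDivisorSeries 3 3 - 3 * dilatedDivisorSeries 1 3) * (dilatedDivisorSeries 1 3 -
      dilatedDivisorSeries 3 3) - 19683 * (dilatedDivisorSeries 1 3 - dilatedDivisorSeries 3 3) ^
      2)) ?_ ?_
  · have b := IsIntLevel.betaThree
    have g := IsIntLevel.gamma 3
    have e6 := IsIntLevel.eis6 3
    have v6 := IsIntLevel.eis6_V 3
    convert (e6.mul (((b.mul b).add ((b.mul g).intCast_mul 18)).sub
      ((g.mul g).intCast_mul 27))).sub (v6.mul (((b.mul b).sub ((b.mul g).intCast_mul 486)).sub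
      ((g.mul g).intCast_mul 19683))) using 1
    push_cast
    ring
  · simp only [map_sub, map_add, map_mul, map_pow, map_one, map_ofNat,
      ofPowerSeries_dilatedDivisorSeries, laurentV_one, eis6, betaThree, gammaSeries]
  · obtain ⟨x, hX⟩ : ∃ x, Ideal.Quotient.mk
        (Ideal.span {(PowerSeries.X : PowerSeries ℤ) ^ 5}) PowerSeries.X = x := ⟨_, rfl⟩
    have hx : x ^ 5 = 0 := by
      rw [← hX, ← map_pow, Ideal.Quotient.eq_zero_iff_mem]
      exact Ideal.mem_span_singleton_self _
    obtain ⟨h31, -, h33⟩ := mk_dilatedDivisorSeries (by norm_num) hX 3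
    obtain ⟨h51, -, h53⟩ := mk_dilatedDivisorSeries (by norm_num) hX 5
    simp only [map_sub, map_add, map_mul, map_pow, map_one, map_ofNat, h31, h33, h51, h53]
    linear_combination (3919104 * x + 58919616 * x ^ 2 + 657332928 * x ^ 3 + 4581360000 * x ^
      4 + 21612915072 * x ^ 5 + 139787436096 * x ^ 6 + 658271033280 * x ^ 7 + 1505023244928 *
      x ^ 8 + 2695720414464 * x ^ 9 + 1800914508288 * x ^ 10) * hx

lemma laurent_1728_mul_left_cancel {s t : LaurentSeries ℤ} (h : 1728 * s = 1728 * t) : s = t := by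
  ext n
  refine mul_left_cancel₀ (by norm_num : (1728 : ℤ) ≠ 0) ?_
  exact (laurent_ofNat_mul_coeff 1728 s n).symm.trans (h ▸ laurent_ofNat_mul_coeff 1728 t n)

lemma levelTwoRelations : LevelTwoRelations where
  disc := by
    refine laurent_1728_mul_left_cancel ?_
    rw [discSeries_eq]
    exact sub_eq_zero.mp level_two_disc
  disc_V := by
    refine laurent_1728_mul_left_cancel ?_
    rw [laurentV_discSeries_eq]
    exact sub_eq_zero.mp level_two_disc_V
  eis6 := sub_eq_zero.mp level_two_eis6

lemma levelThreeRelations : LevelThreeRelations where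
  disc := by
    refine laurent_1728_mul_left_cancel ?_
    rw [mul_left_comm 1728 (betaThree + _), discSeries_eq]
    exact sub_eq_zero.mp level_three_disc
  disc_V := by
    refine laurent_1728_mul_left_cancel ?_
    rw [mul_left_comm 1728 (betaThree + _), laurentV_discSeries_eq]
    exact sub_eq_zero.mp level_three_disc_V
  eis6 := sub_eq_zero.mp level_three_eis6

end Relations

section Arithmetic

/-- The Hecke relations force `P ^ r * A r s` to be symmetric in `r` and `s`. -/
lemma pow_mul_symm {A : ℕ → ℕ → ℤ} {P : ℤ}
    (H : ∀ r s, P * (if s = 0 then 0 else A r (s - 1)) + A r (s + 1) =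
      P * A (r + 1) s + if r = 0 then 0 else A (r - 1) s) (r s : ℕ) :
    P ^ r * A r s = P ^ s * A s r := by
  obtain ⟨D, hD⟩ : ∃ D : ℕ → ℕ → ℤ, ∀ r s, D r s = P ^ r * A r s - P ^ s * A s r :=
    ⟨_, fun _ _ => rfl⟩
  have hrec (r s) : D r (s + 1) + P * (if s = 0 then 0 else D r (s - 1)) =
      D (r + 1) s + P * (if r = 0 then 0 else D (r - 1) s) := by
    have h1 := H r s
    have h2 := H s r
    rcases r with - | r <;> rcases s with - | s <;> simp [hD, pow_succ] at * <;>
      grind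
  have hD0 (t) : ∀ r s, r + s = t → D r s = 0 := by
    induction t using Nat.strong_induction_on with
    | _ t ih =>
      have hstep (r s) (h : r + s + 1 = t) : D r (s + 1) = D (r + 1) s := by
        have := hrec r s
        have h1 : (if s = 0 then 0 else D r (s - 1)) = 0 := by
          split_ifs
          · rfl
          · exact ih (r + (s - 1)) (by omega) _ _ rfl
        have h2 : (if r = 0 then 0 else D (r - 1) s) = 0 := by
          split_ifs
          · rfl
          · exact ih (r - 1 + s) (by omega) _ _ rfl
        simpa [h1, h2] using this
      have hconst (r) : ∀ s, r + s = t → D r s = D 0 t := by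
        induction r with
        | zero => rintro s rfl; rw [zero_add]
        | succ r ih' => exact fun s h => (hstep r s (by omega)).symm.trans (ih' _ (by omega))
      intro r s h
      have h1 := hconst t 0 (by omega)
      have h2 := hD t 0
      have h3 := hD 0 t
      rw [hconst r s h]
      omega
  linarith [hD0 _ r s rfl, hD r s]

lemma dvd_of_hecke_of_congruence {A : ℕ → ℕ → ℤ} {P N : ℤ} (hP : P ≠ 0)
    (H : ∀ r s, P * (if s = 0 then 0 else A r (s - 1)) + A r (s + 1) =
      P * A (r + 1) s + if r = 0 then 0 else A (r - 1) s)
    (C : ∀ r s, N ∣ A (r + 1) s - if s = 0 then 0 else A r (s - 1)) (r s : ℕ) :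
    (s < r → N ∣ A r s) ∧ (r < s → P ^ (s - r) * N ∣ A r s) := by
  have h1 (s) : ∀ r, s < r → N ∣ A r s := by
    induction s with
    | zero =>
      intro r h
      obtain ⟨r, rfl⟩ := Nat.exists_eq_add_of_lt h
      simpa using C (0 + r) 0
    | succ s ih =>
      intro r h
      obtain ⟨r, rfl⟩ := Nat.exists_eq_add_of_lt h
      have := C (s + 1 + r) (s + 1)
      rw [if_neg s.succ_ne_zero, Nat.add_sub_cancel] at this
      exact (dvd_sub_left (ih _ (by omega))).mp this
  refine ⟨h1 s r, fun h => ?_⟩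
  have h2 := pow_mul_symm H r s
  rw [show P ^ s = P ^ r * P ^ (s - r) by rw [← pow_add]; congr 1; omega, mul_assoc] at h2
  rw [mul_left_cancel₀ (pow_ne_zero r hP) h2]
  exact mul_dvd_mul_left _ (h1 r s h)

end Arithmetic

section Coefficients

variable {p k b c : ℕ} {a : ℤ → ℤ → ℤ}

lemma IsWeightPair.exists_of_mem (hk : k ∈ ({4, 6, 8, 10, 14} : Set ℕ)) :
    ∃ b c, IsWeightPair k b c := by
  rcases hk with rfl | rfl | rfl | rfl | rfl
  exacts [⟨1, 0, by simp [IsWeightPair]⟩, ⟨0, 1, by simp [IsWeightPair]⟩,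
    ⟨2, 0, by simp [IsWeightPair]⟩, ⟨1, 1, by simp [IsWeightPair]⟩, ⟨2, 1, by simp [IsWeightPair]⟩]

lemma IsCoeffs.exists_series (ha : IsCoeffs k a) (hk : IsWeightPair k b c) (m : ℕ) :
    ∃ (f : ℍ → ℂ) (P : Polynomial ℤ),
      IsLevelOne k f (laurentComplex (eisMonomial b c * P.eval₂ HahnSeries.C jSeries)) ∧
      IsPrincipal (eisMonomial b c * P.eval₂ HahnSeries.C jSeries) m ∧
      ∀ n > 0, (eisMonomial b c * P.eval₂ HahnSeries.C jSeries).coeff n = a m n := by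
  obtain ⟨f, hf, hn⟩ := ha.1 m (by positivity)
  obtain ⟨P, hP⟩ := hf.exists_eisMonomial_mul_eval₂ hk
  have hc (n : ℤ) : ((eisMonomial b c * P.eval₂ HahnSeries.C jSeries).coeff n : ℂ) = f.coeff n := by
    rw [← f.series_coeff, ← hP, laurentMap_coeff, eq_intCast]
  refine ⟨f.toFun, P, hP ▸ f.isLevelOne, fun n h => ?_, fun n h => ?_⟩
  · rw [← Int.cast_inj (α := ℂ), hc]
    split_ifs with h'
    · rw [h', hf.1, Int.cast_one]
    · rw [hf.2 n h' h, Int.cast_zero]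
  · rw [← Int.cast_inj (α := ℂ), hc, hn n h]

lemma IsCoeffs.congruence [NeZero p] (ha : IsCoeffs k a) (hk : IsWeightPair k b c) {N : ℕ}
    (hr : HasReduction N p (weightModulus k) (eisMonomial b c)) {m : ℕ} (hm : 0 < m) {n : ℤ}
    (hn : 0 < n) : (N : ℤ) ∣ a (p * m) n - if (p : ℤ) ∣ n then a m (n / p) else 0 := by
  obtain ⟨-, P, -, hP, hPn⟩ := ha.exists_series hk m
  obtain ⟨-, P', -, hP', hPn'⟩ := ha.exists_series hk (p * m)
  obtain ⟨u, ρ, Q, hVW, hρ, hQ, hu⟩ := hr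
  have h := principal_congruence hm (isMonicAt_eisMonomial b c) isMonicAt_jSeries hP hP'
    (fun i hi => dvd_coeff_zero_mul_jSeries_pow eulerOp_eis4_discSeries (weightModulus_dvd hk) hi)
    hVW hρ hQ hu n
  rw [hPn' n hn, laurentV_coeff, Nat.cast_mul] at h
  convert h using 3 with hpn
  exact (hPn _ (Int.ediv_pos_of_pos_of_dvd hn (by positivity) hpn)).symm

lemma IsCoeffs.hecke [Fact p.Prime] (ha : IsCoeffs k a) (hk : IsWeightPair k b c) {m : ℕ}
    (hm : 0 < m) {n : ℤ} (hn : 0 < n) :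
    (p : ℤ) ^ (k - 1) * (if (p : ℤ) ∣ n then a m (n / p) else 0) + a m (p * n) =
      (p : ℤ) ^ (k - 1) * a (p * m) n + if p ∣ m then a (m / p : ℕ) n else 0 := by
  have hp : (0 : ℤ) < p := by exact_mod_cast (Fact.out : p.Prime).pos
  obtain ⟨f, P, hf, hP, hPn⟩ := ha.exists_series hk m
  obtain ⟨g, P', hg, hP', hPn'⟩ := ha.exists_series hk (p * m)
  obtain ⟨h, u, hh, hu, hun⟩ : ∃ (h : ℍ → ℂ) (u : LaurentSeries ℤ),
      IsLevelOne k h (laurentComplex u) ∧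
      (∀ n : ℤ, n ≤ 0 → u.coeff n = if p * n = -(m : ℤ) then 1 else 0) ∧
      ∀ n > 0, u.coeff n = if p ∣ m then a (m / p : ℕ) n else 0 := by
    by_cases hpm : p ∣ m
    · obtain ⟨h, Q, hh, hQ, hQn⟩ := ha.exists_series hk (m / p)
      refine ⟨h, _, hh, fun n hn => ?_, fun n hn => ?_⟩
      · rw [hQ n hn]
        obtain ⟨m, rfl⟩ := hpm
        rw [Nat.mul_div_cancel_left _ (by exact_mod_cast hp)]
        congr 1
        push_cast
        rw [← mul_neg, mul_right_inj' hp.ne']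
      · rw [hQn n hn, if_pos hpm]
    · refine ⟨0, 0, ?_, fun n _ => ?_, fun n _ => ?_⟩
      · rw [map_zero]
        simpa using hf.sub hf
      · rw [if_neg, HahnSeries.coeff_zero]
        intro h
        exact hpm (Int.natCast_dvd_natCast.mp (dvd_neg.mp ⟨n, h.symm⟩))
      · rw [if_neg hpm, HahnSeries.coeff_zero]
  have hk1 : 1 ≤ k := by rcases hk with h | h | h | h | h <;> omega
  have key := hecke_relation (p := p) (m := m)
    (by rcases hk with h | h | h | h | h <;> omega) hf hg hh
    (fun n hn => ?_) (fun n hn => ?_) (fun n hn => ?_) n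
  · rw [← Nat.cast_pred (R := ℤ) (by omega), zpow_natCast, ← laurentMap_laurentV, laurentMap_coeff,
      laurentMap_coeff, laurentMap_coeff, laurentMap_coeff, laurentV_coeff,
      hPn (p * n) (mul_pos hp hn),
      hPn' n hn, hun n hn, Nat.cast_mul] at key
    simp only [eq_intCast] at key
    have hV : (if (p : ℤ) ∣ n then a m (n / p) else 0) = if (p : ℤ) ∣ n then
        (eisMonomial b c * P.eval₂ HahnSeries.C jSeries).coeff (n / p) else 0 := by
      split_ifs with hpn
      · exact (hPn _ (Int.ediv_pos_of_pos_of_dvd hn hp.le hpn)).symm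
      · rfl
    rw [hV]
    exact_mod_cast key
  · rw [laurentMap_coeff, hP n hn]; split_ifs <;> simp
  · rw [laurentMap_coeff, hP' n hn]; split_ifs <;> simp
  · rw [laurentMap_coeff, hu n hn]; split_ifs <;> simp

lemma hasReduction_of_mem (hp : p ∈ ({2, 3, 5} : Set ℕ)) [NeZero p] (hk : IsWeightPair k b c) :
    HasReduction (p ^ eps k p) p (weightModulus k) (eisMonomial b c) := by
  rcases hp with rfl | rfl | rfl
  exacts [hasReduction_two levelTwoRelations hk, hasReduction_three levelThreeRelations hk,
    hasReduction_five hk]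

end Coefficients

/-- Main theorem: divisibility of the coefficients `a_k(m,n)` by powers of
`p ∈ {2,3,5}` according to the `p`-adic valuations of `m` and `n`. -/
theorem stmt_19 (p : ℕ) (hp : p ∈ ({2, 3, 5} : Set ℕ)) (k : ℕ)
    (hk : k ∈ ({4, 6, 8, 10, 14} : Set ℕ))
    (a : ℤ → ℤ → ℤ) (ha : IsCoeffs k a) (m n : ℤ) (hm : 0 < m) (hn : 0 < n) :
    (padicValInt p n < padicValInt p m → (p : ℤ) ^ eps k p ∣ a m n) ∧
    (padicValInt p m < padicValInt p n →
      (p : ℤ) ^ ((padicValInt p n - padicValInt p m) * (k - 1) + eps k p) ∣ a m n) := by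
  have : Fact p.Prime := ⟨by rcases hp with rfl | rfl | rfl <;> norm_num⟩
  have hp0 : p ≠ 0 := NeZero.ne p
  obtain ⟨b, c, hbc⟩ := IsWeightPair.exists_of_mem hk
  have hr := hasReduction_of_mem hp hbc
  lift m to ℕ using hm.le
  lift n to ℕ using hn.le
  norm_cast at hm hn
  simp only [padicValInt.of_nat]
  obtain ⟨r, m, hpm, rfl⟩ := Nat.exists_eq_pow_mul_and_not_dvd hm.ne' p (Nat.Prime.ne_one Fact.out)
  obtain ⟨s, n, hpn, rfl⟩ := Nat.exists_eq_pow_mul_and_not_dvd hn.ne' p (Nat.Prime.ne_one Fact.out)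
  have hm0 : 0 < m := Nat.pos_of_mul_pos_left hm
  have hn0 : 0 < n := Nat.pos_of_mul_pos_left hn
  have hv (r m : ℕ) (h : ¬ p ∣ m) (hm0 : 0 < m) : padicValNat p (p ^ r * m) = r := by
    rw [padicValNat.mul (by positivity) hm0.ne', padicValNat.prime_pow,
      padicValNat.eq_zero_of_not_dvd h, add_zero]
  rw [hv r m hpm hm0, hv s n hpn hn0]
  have hdvd (r m : ℕ) (h : ¬ p ∣ m) : p ∣ p ^ r * m ↔ r ≠ 0 := by
    rcases r with - | r
    · simpa using h
    · simp [pow_succ', mul_assoc]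
  have hdiv (r m : ℕ) (h : r ≠ 0) : p ^ r * m / p = p ^ (r - 1) * m := by
    obtain ⟨r, rfl⟩ := Nat.exists_eq_succ_of_ne_zero h
    rw [pow_succ', mul_assoc, Nat.mul_div_cancel_left _ hp0.bot_lt, Nat.succ_sub_one]
  have hif (s : ℕ) (F : ℕ → ℤ) (m : ℕ) (h : ¬ p ∣ m) : (if p ∣ p ^ s * m then
      F (p ^ s * m / p) else 0) = if s = 0 then 0 else F (p ^ (s - 1) * m) := by
    simp only [hdvd s m h]
    by_cases hs : s = 0
    · simp [hs]
    · simp [hs, hdiv s m hs]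
  have key := dvd_of_hecke_of_congruence
    (A := fun r s => a ((p ^ r * m : ℕ) : ℤ) ((p ^ s * n : ℕ) : ℤ)) (P := (p : ℤ) ^ (k - 1))
    (N := ((p ^ eps k p : ℕ) : ℤ)) (by positivity) (fun r s => ?_) (fun r s => ?_) r s
  · rw [← pow_mul, mul_comm (k - 1), Nat.cast_pow, ← pow_add] at key
    exact key
  · have h := ha.hecke (p := p) hbc (m := p ^ r * m) (by positivity) (n := (p ^ s * n : ℕ))
      (by positivity)
    simp only [Int.natCast_dvd_natCast, ← Int.natCast_div, ← Nat.cast_mul] at h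
    rw [hif s (fun x => a _ x) n hpn, hif r (fun x => a x _) m hpm] at h
    simpa only [pow_succ', mul_assoc] using h
  · have h := ha.congruence (p := p) hbc hr (m := p ^ r * m) (by positivity) (n := (p ^ s * n : ℕ))
      (by positivity)
    simp only [Int.natCast_dvd_natCast, ← Int.natCast_div, ← Nat.cast_mul] at h
    rw [hif s (fun x => a _ x) n hpn] at h
    simpa only [pow_succ', mul_assoc] using h
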